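/- arXiv:1712.02176 — 7 statements merged into one kernel-verified Lean document; each statement's English description precedes it below -/
import Mathlib

section
/- Let ℓ, k be positive integers, D ⊆ ℝ^ℓ a convex set, and σ : ℝ^ℓ → ℝ^k an affine map. Then for every δ > 0 there exists a family 𝓗 of at most (1 + ((1+δ)/δ)·Flt(k))^k affine subspaces of ℝ^ℓ such that the sets D_σ := conv(D ∩ σ⁻¹(ℤ^k)) and D_𝓗 := conv(D ∩ ⋃_{H∈𝓗} H) satisfy (a) D_σ ⊆ D_𝓗 and (b) rdist(D_σ, D_𝓗) ≤ δ. -/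
open scoped ENNReal Pointwise

/-- The relative distance between two sets `A ⊆ B ⊆ ℝ^ι`:
`rdist(A,B) = sup_{π linear} d_H(π(A),π(B)) / diam(π(A))`, computed in `ℝ≥0∞`,
so that a fraction with `∞` in the denominator as well as `0/0` is `0`,
`rdist(∅,∅) = 0` and `rdist(∅,B) = ∞` for `B ≠ ∅`. -/
noncomputable def relDist {ι : Type*} (A B : Set (ι → ℝ)) : ℝ≥0∞ :=
  ⨆ π : (ι → ℝ) →ₗ[ℝ] ℝ,
    (⨆ b ∈ B, ⨅ a ∈ A, ENNReal.ofReal |π b - π a|) /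
      (⨆ a ∈ A, ⨆ a' ∈ A, ENNReal.ofReal |π a - π a'|)

/-- A point of `ℝ^k` all of whose coordinates are integers. -/
def IsLatticePoint {k : ℕ} (z : Fin k → ℝ) : Prop := ∀ i, ∃ n : ℤ, z i = (n : ℝ)

/-- The lattice width of a set `B ⊆ ℝ^k`:
`width(B) = inf_{v ∈ ℤ^k \ {0}} (sup_{x ∈ B} vᵀx - inf_{x ∈ B} vᵀx)`, in `ℝ≥0∞`. -/
noncomputable def latticeWidth {k : ℕ} (B : Set (Fin k → ℝ)) : ℝ≥0∞ :=
  ⨅ v ∈ {v : Fin k → ℤ | v ≠ 0},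
    ⨆ x ∈ B, ⨆ y ∈ B, ENNReal.ofReal (∑ i, (v i : ℝ) * (x i - y i))

/-- The flatness constant `Flt(k)`: the smallest `λ` bounding the lattice width of every
convex, closed, full-dimensional and lattice-free subset of `ℝ^k`. -/
noncomputable def flatnessConst (k : ℕ) : ℝ≥0∞ :=
  ⨆ B ∈ {B : Set (Fin k → ℝ) | Convex ℝ B ∧ IsClosed B ∧ affineSpan ℝ B = ⊤ ∧
      ∀ x ∈ B, ¬ IsLatticePoint x}, latticeWidth B

/-- The linear functional `x ↦ vᵀx` on `ℝ^k` given by an integer vector `v`. -/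
noncomputable def intForm {k : ℕ} (v : Fin k → ℤ) : (Fin k → ℝ) →ₗ[ℝ] ℝ :=
  ∑ i, (v i : ℝ) • LinearMap.proj i

lemma intForm_apply {k : ℕ} (v : Fin k → ℤ) (x : Fin k → ℝ) :
    intForm v x = ∑ i, (v i : ℝ) * x i := by
  simp [intForm]

lemma intForm_single {k : ℕ} (v : Fin k → ℤ) (i : Fin k) (r : ℝ) :
    intForm v (Pi.single i r) = v i * r := by
  simp [intForm_apply, Pi.single_apply]

lemma intForm_add {k : ℕ} (u v : Fin k → ℤ) : intForm (u + v) = intForm u + intForm v := by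
  simp [intForm, add_smul, Finset.sum_add_distrib]

lemma intForm_smul {k : ℕ} (n : ℤ) (v : Fin k → ℤ) :
    intForm (n • v) = (n : ℝ) • intForm v := by
  simp [intForm, mul_smul, Finset.smul_sum]

lemma intForm_cons_cons {k : ℕ} (a : ℤ) (u : Fin k → ℤ) (b : ℝ) (y : Fin k → ℝ) :
    intForm (Fin.cons a u : Fin (k + 1) → ℤ) (Fin.cons b y : Fin (k + 1) → ℝ) =
      a * b + intForm u y := by
  simp [intForm_apply, Fin.sum_univ_succ]

lemma isLatticePoint_iff_exists {k : ℕ} {z : Fin k → ℝ} :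
    IsLatticePoint z ↔ ∃ w : Fin k → ℤ, z = fun i => (w i : ℝ) := by
  constructor
  · intro h
    choose w hw using h
    exact ⟨w, funext hw⟩
  · rintro ⟨w, rfl⟩ i
    exact ⟨w i, rfl⟩

lemma isLatticePoint_succ_iff {k : ℕ} {z : Fin (k + 1) → ℝ} :
    IsLatticePoint z ↔ (∃ n : ℤ, z 0 = n) ∧ IsLatticePoint (Fin.tail z) :=
  Fin.forall_fin_succ

lemma IsLatticePoint.exists_intForm_eq {k : ℕ} {z : Fin k → ℝ} (hz : IsLatticePoint z)
    (v : Fin k → ℤ) : ∃ n : ℤ, intForm v z = n := by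
  obtain ⟨w, rfl⟩ := isLatticePoint_iff_exists.1 hz
  exact ⟨∑ i, v i * w i, by simp [intForm_apply]⟩

lemma exists_eq_intForm {k : ℕ} (f : (Fin k → ℝ) →ₗ[ℝ] ℝ)
    (hf : ∀ z, IsLatticePoint z → ∃ n : ℤ, f z = n) : ∃ v, f = intForm v := by
  have h : ∀ i, ∃ n : ℤ, f (Pi.single i 1) = n := fun i => hf _ fun j => by
    by_cases h : j = i
    · exact ⟨1, by simp [h]⟩
    · exact ⟨0, by simp [h]⟩
  choose v hv using h
  refine ⟨v, LinearMap.pi_ext' fun i => LinearMap.ext_ring ?_⟩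
  simpa [intForm_single] using hv i

/-- Every nonzero integer vector is a multiple of a primitive one. -/
lemma exists_smul_primitive {k : ℕ} {v : Fin k → ℤ} (hv : v ≠ 0) :
    ∃ (g : ℤ) (u e : Fin k → ℤ), g ≠ 0 ∧ v = g • u ∧ ∑ i, u i * e i = 1 := by
  let φ : (Fin k → ℤ) →ₗ[ℤ] ℤ := ∑ i, v i • LinearMap.proj i
  have hφ : ∀ w, φ w = ∑ i, v i * w i := fun w => by simp [φ]
  obtain ⟨g, hg⟩ := (IsPrincipalIdealRing.principal (LinearMap.range φ)).principal
  have hdvd : ∀ i, g ∣ v i := fun i => by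
    have : φ (Pi.single i 1) ∈ LinearMap.range φ := ⟨_, rfl⟩
    rw [hg] at this
    simpa [hφ, Pi.single_apply, Ideal.mem_span_singleton] using this
  choose u hu using hdvd
  have hgr : g ∈ LinearMap.range φ := hg ▸ Submodule.mem_span_singleton_self g
  obtain ⟨e, he⟩ := hgr
  have hg0 : g ≠ 0 := by
    rintro rfl
    exact hv (funext fun i => by simp [hu i])
  refine ⟨g, u, e, hg0, funext fun i => by simp [hu i], ?_⟩
  rw [hφ] at he
  refine mul_left_cancel₀ hg0 ?_
  rw [Finset.mul_sum, mul_one]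
  simpa [hu, mul_assoc] using he

/-- A primitive integer vector is the first coordinate function of a `ℤ`-basis of `ℤ^(k+1)`. -/
lemma exists_basis_repr_zero {k : ℕ} {u e : Fin (k + 1) → ℤ} (h : ∑ i, u i * e i = 1) :
    ∃ b : Module.Basis (Fin (k + 1)) ℤ (Fin (k + 1) → ℤ),
      ∀ w, b.repr w 0 = ∑ i, u i * w i := by
  let φ : (Fin (k + 1) → ℤ) →ₗ[ℤ] ℤ := ∑ i, u i • LinearMap.proj i
  have hφ : ∀ w, φ w = ∑ i, u i * w i := fun w => by simp [φ]
  have he : φ e = 1 := by rw [hφ, h]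
  have hli : ∀ c : ℤ, ∀ x ∈ LinearMap.ker φ, c • e + x = 0 → c = 0 := fun c x hx hc => by
    have := congrArg φ hc
    rw [LinearMap.mem_ker] at hx
    rwa [map_add, map_smul, he, hx, add_zero, smul_eq_mul, mul_one, map_zero] at this
  have hsp : ∀ z, ∃ c : ℤ, z + c • e ∈ LinearMap.ker φ := fun z =>
    ⟨-φ z, by rw [LinearMap.mem_ker, map_add, map_smul, he, smul_eq_mul, mul_one, add_neg_cancel]⟩
  obtain ⟨m, b⟩ := Submodule.basisOfPid (Pi.basisFun ℤ (Fin (k + 1))) (LinearMap.ker φ)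
  have hm : m = k := by
    simpa using Fintype.card_congr
      ((Module.Basis.mkFinCons e b hli hsp).indexEquiv (Pi.basisFun ℤ (Fin (k + 1))))
  subst hm
  refine ⟨Module.Basis.mkFinCons e b hli hsp, fun w => ?_⟩
  rw [← hφ]
  change (Module.Basis.mkFinCons e b hli hsp).coord 0 w = φ w
  congr 1
  refine (Module.Basis.mkFinCons e b hli hsp).ext fun i => ?_
  rw [Module.Basis.coord_apply, Module.Basis.repr_self, Module.Basis.coe_mkFinCons]
  refine Fin.cases ?_ (fun j => ?_) i
  · simp [he]
  · simp

/-- A primitive integer vector is the first row of a unimodular transformation. -/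
lemma exists_unimodular {k : ℕ} {u e : Fin (k + 1) → ℤ} (h : ∑ i, u i * e i = 1) :
    ∃ T : (Fin (k + 1) → ℝ) ≃ₗ[ℝ] (Fin (k + 1) → ℝ),
      (∀ z, T z 0 = intForm u z) ∧ ∀ z, IsLatticePoint (T z) ↔ IsLatticePoint z := by
  obtain ⟨b, hb⟩ := exists_basis_repr_zero h
  let A := LinearMap.toMatrix' (b.equivFun : (Fin (k + 1) → ℤ) →ₗ[ℤ] (Fin (k + 1) → ℤ))
  let A' := LinearMap.toMatrix' (b.equivFun.symm : (Fin (k + 1) → ℤ) →ₗ[ℤ] (Fin (k + 1) → ℤ))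
  have h₁ : A * A' = 1 := (LinearMap.toMatrix'_comp _ _).symm.trans (by simp)
  have h₂ : A' * A = 1 := (LinearMap.toMatrix'_comp _ _).symm.trans (by simp)
  let ι := Int.castRingHom ℝ
  have hι : ∀ M N : Matrix (Fin (k + 1)) (Fin (k + 1)) ℤ, M * N = 1 → M.map ι * N.map ι = 1 :=
    fun M N hMN => by rw [← Matrix.map_mul, hMN, Matrix.map_one _ ι.map_zero ι.map_one]
  have hlat : ∀ (M : Matrix (Fin (k + 1)) (Fin (k + 1)) ℤ) z, IsLatticePoint z →
      IsLatticePoint (Matrix.mulVec (M.map ι) z) := fun M z hz => by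
    obtain ⟨w, rfl⟩ := isLatticePoint_iff_exists.1 hz
    exact fun i => ⟨∑ j, M i j * w j, by simp [Matrix.mulVec, dotProduct, ι]⟩
  let T := Matrix.toLin'OfInv (hι A' A h₂) (hι A A' h₁)
  have hT : ∀ z, T z = Matrix.mulVec (A.map ι) z := fun z => rfl
  have hT' : ∀ z, T.symm z = Matrix.mulVec (A'.map ι) z := fun z => rfl
  refine ⟨T, fun z => ?_, fun z => ⟨fun hz => ?_, fun hz => ?_⟩⟩
  · rw [hT, intForm_apply, Matrix.mulVec, dotProduct]
    refine Finset.sum_congr rfl fun j _ => ?_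
    have : A 0 j = u j := by
      simp [A, LinearMap.toMatrix'_apply, hb, Pi.single_apply]
    simp [this, ι]
  · rw [← T.symm_apply_apply z, hT']
    exact hlat _ _ hz
  · rw [hT]
    exact hlat _ _ hz

/-- If the projection of a convex set to a plane through the origin is wide in all directions
`(s, 1)`, then two points with equal first coordinate are far apart with respect to `f`. -/
lemma exists_sub_mem_ker {E : Type*} [AddCommGroup E] [Module ℝ E] [TopologicalSpace E]
    {K : Set E} (hK : IsCompact K) (hconv : Convex ℝ K) (hne : K.Nonempty)
    (e f : E →ₗ[ℝ] ℝ) (he : Continuous e) (hf : Continuous f) {w : ℝ} (hw : 0 < w)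
    (h : ∀ s : ℝ, ∃ x ∈ K, ∃ y ∈ K, w ≤ f x - f y + s * (e x - e y)) :
    ∃ x ∈ K, ∃ y ∈ K, e x = e y ∧ f x - f y = w := by
  let F : E × E →ₗ[ℝ] ℝ × ℝ := LinearMap.prod
    (e ∘ₗ LinearMap.fst ℝ E E - e ∘ₗ LinearMap.snd ℝ E E)
    (f ∘ₗ LinearMap.fst ℝ E E - f ∘ₗ LinearMap.snd ℝ E E)
  have hF : ∀ x y, F (x, y) = (e x - e y, f x - f y) := fun x y => rfl
  have hFc : Continuous F := by
    change Continuous fun p : E × E => (e p.1 - e p.2, f p.1 - f p.2)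
    fun_prop
  have hcomp : IsCompact (F '' (K ×ˢ K)) := (hK.prod hK).image hFc
  have hC : Convex ℝ (F '' (K ×ˢ K)) := (hconv.prod hconv).linear_image F
  by_contra hcon
  have hnot : ((0, w) : ℝ × ℝ) ∉ F '' (K ×ˢ K) := by
    rintro ⟨⟨x, y⟩, ⟨hx, hy⟩, hxy⟩
    rw [hF, Prod.mk.injEq] at hxy
    exact hcon ⟨x, hx, y, hy, sub_eq_zero.1 hxy.1, hxy.2⟩
  obtain ⟨g, r, hg, hr⟩ := geometric_hahn_banach_closed_point hC hcomp.isClosed hnot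
  have hsplit : ∀ a b, g (a, b) = a * g (1, 0) + b * g (0, 1) := fun a b => by
    rw [← smul_eq_mul, ← smul_eq_mul, ← map_smul, ← map_smul, ← map_add]
    simp
  have hlt : ∀ x ∈ K, ∀ y ∈ K,
      (e x - e y) * g (1, 0) + (f x - f y) * g (0, 1) < w * g (0, 1) := fun x hx y hy => by
    have h₁ := hg _ ⟨(x, y), ⟨hx, hy⟩, rfl⟩
    rw [hF, hsplit] at h₁
    rw [hsplit, zero_mul, zero_add] at hr
    exact h₁.trans hr
  obtain ⟨x₀, hx₀⟩ := hne
  have hpos : 0 < g (0, 1) := by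
    have := hlt x₀ hx₀ x₀ hx₀
    simp only [sub_self, zero_mul, add_zero] at this
    exact pos_of_mul_pos_right this hw.le
  obtain ⟨x, hx, y, hy, hxy⟩ := h (g (1, 0) / g (0, 1))
  have h₁ := hlt x hx y hy
  have h₂ := mul_le_mul_of_nonneg_right hxy hpos.le
  have h₃ : (f x - f y + g (1, 0) / g (0, 1) * (e x - e y)) * g (0, 1) =
      (e x - e y) * g (1, 0) + (f x - f y) * g (0, 1) := by
    field_simp
    ring
  linarith

/-- A compact convex set of lattice width at least `L` whose width in direction `e₀` is at most
`3L/2` has a slice of lattice width at least `L/24` by an integral hyperplane orthogonal to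
`e₀`. -/
lemma exists_wide_slice {k : ℕ} {K : Set (Fin (k + 1) → ℝ)} (hK : IsCompact K)
    (hconv : Convex ℝ K) {L : ℝ} (hL : 2 ≤ L)
    (hw : ∀ v : Fin (k + 1) → ℤ, v ≠ 0 → ∃ x ∈ K, ∃ y ∈ K, L ≤ intForm v x - intForm v y)
    (h0 : ∀ x ∈ K, ∀ y ∈ K, x 0 - y 0 ≤ 3 / 2 * L) :
    ∃ n : ℤ, (∃ y : Fin k → ℝ, (Fin.cons (n : ℝ) y : Fin (k + 1) → ℝ) ∈ K) ∧
      ∀ u : Fin k → ℤ, u ≠ 0 → ∃ y : Fin k → ℝ, (Fin.cons (n : ℝ) y : Fin (k + 1) → ℝ) ∈ K ∧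
        ∃ y' : Fin k → ℝ, (Fin.cons (n : ℝ) y' : Fin (k + 1) → ℝ) ∈ K ∧
          L / 24 ≤ intForm u y - intForm u y' := by
  have hcoord : ∀ x : Fin (k + 1) → ℝ, intForm (Pi.single 0 1) x = x 0 := fun x => by
    simp [intForm_apply, Pi.single_apply]
  obtain ⟨p, hp, q, hq, hpq⟩ := hw (Pi.single 0 1) (by simp)
  rw [hcoord, hcoord] at hpq
  obtain ⟨n, hn⟩ : ∃ n : ℤ, |(p 0 + q 0) / 2 - n| ≤ 1 / 2 := ⟨_, abs_sub_round _⟩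
  rw [abs_le] at hn
  -- A pair of points on a common level can be moved to level `n` by a contraction.
  have hmove : ∀ x ∈ K, ∀ x' ∈ K, x 0 = x' 0 → ∃ t : ℝ, 1 / 6 ≤ t ∧
      ∃ y : Fin k → ℝ, (Fin.cons (n : ℝ) y : Fin (k + 1) → ℝ) ∈ K ∧
        ∃ y' : Fin k → ℝ, (Fin.cons (n : ℝ) y' : Fin (k + 1) → ℝ) ∈ K ∧
          y - y' = t • Fin.tail (x - x') := by
    intro x hx x' hx' hxx'
    obtain ⟨r, hr, t, ht, ht1, hrt⟩ : ∃ r ∈ K, ∃ t : ℝ, 1 / 6 ≤ t ∧ t ≤ 1 ∧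
        (1 - t) * r 0 + t * x 0 = n := by
      rcases le_or_gt (n : ℝ) (x 0) with h | h
      · have hpos : 0 < x 0 - q 0 := by linarith
        refine ⟨q, hq, (n - q 0) / (x 0 - q 0), ?_, ?_, ?_⟩
        · rw [le_div_iff₀ hpos]
          linarith [h0 x hx q hq]
        · rw [div_le_one hpos]
          linarith
        · field_simp
          ring
      · have hpos : 0 < p 0 - x 0 := by linarith
        refine ⟨p, hp, (p 0 - n) / (p 0 - x 0), ?_, ?_, ?_⟩
        · rw [le_div_iff₀ hpos]
          linarith [h0 p hp x hx]
        · rw [div_le_one hpos]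
          linarith
        · field_simp
          ring
    have hmem : ∀ z ∈ K, z 0 = x 0 →
        (Fin.cons (n : ℝ) (Fin.tail ((1 - t) • r + t • z)) : Fin (k + 1) → ℝ) ∈ K := by
      intro z hz hz0
      have h₁ : ((1 - t) • r + t • z) 0 = n := by simp [hz0, hrt]
      rw [← h₁, Fin.cons_self_tail]
      exact hconv hr hz (by linarith) (by linarith) (by ring)
    refine ⟨t, ht, _, hmem x hx rfl, _, hmem x' hx' hxx'.symm, ?_⟩
    ext i
    simp only [Fin.tail, Pi.sub_apply, Pi.add_apply, Pi.smul_apply, smul_eq_mul]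
    ring
  refine ⟨n, ?_, fun u hu => ?_⟩
  · obtain ⟨t, -, y, hy, -⟩ := hmove p hp p hp rfl
    exact ⟨y, hy⟩
  · let u' : Fin (k + 1) → ℤ := Fin.cons 0 u
    obtain ⟨x, hx, x', hx', hxx', hval⟩ := exists_sub_mem_ker hK hconv ⟨p, hp⟩
      (intForm (Pi.single 0 1)) (intForm u') (LinearMap.continuous_of_finiteDimensional _)
      (LinearMap.continuous_of_finiteDimensional _) (w := L / 4) (by linarith) (fun s => by
        have hne : u' + round s • Pi.single 0 1 ≠ 0 := fun h => hu <| funext fun i => by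
          simpa [u'] using congrFun h i.succ
        obtain ⟨x, hx, y, hy, hxy⟩ := hw _ hne
        refine ⟨x, hx, y, hy, ?_⟩
        rw [intForm_add, intForm_smul] at hxy
        simp only [LinearMap.add_apply, LinearMap.smul_apply, smul_eq_mul, hcoord] at hxy ⊢
        have hs := abs_le.1 (abs_sub_round s)
        have h₁ := h0 x hx y hy
        have h₂ := h0 y hy x hx
        have h₃ : |(s - round s) * (x 0 - y 0)| ≤ 1 / 2 * (3 / 2 * L) := by
          rw [abs_mul]
          exact mul_le_mul (abs_sub_round s) (abs_le.2 ⟨by linarith, h₁⟩) (abs_nonneg _)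
            (by norm_num)
        have h₄ := (abs_le.1 h₃).1
        linarith)
    rw [hcoord, hcoord] at hxx'
    obtain ⟨t, ht, y, hy, y', hy', hyy'⟩ := hmove x hx x' hx' hxx'
    refine ⟨y, hy, y', hy', ?_⟩
    have h₁ : intForm u' (x - x') = intForm u (Fin.tail (x - x')) := by
      conv_lhs => rw [← Fin.cons_self_tail (x - x')]
      rw [intForm_cons_cons]
      simp
    rw [← map_sub, hyy', map_smul, ← h₁, map_sub, hval, smul_eq_mul]
    nlinarith

/-- Khinchine's flatness theorem for compact convex sets, with an
explicit constant. -/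
theorem exists_isLatticePoint_of_wide (k : ℕ) {K : Set (Fin k → ℝ)} (hK : IsCompact K)
    (hconv : Convex ℝ K) (hne : K.Nonempty)
    (hw : ∀ v : Fin k → ℤ, v ≠ 0 → ∃ x ∈ K, ∃ y ∈ K,
      2 * 24 ^ k ≤ intForm v x - intForm v y) :
    ∃ z ∈ K, IsLatticePoint z := by
  induction k with
  | zero =>
    obtain ⟨z, hz⟩ := hne
    exact ⟨z, hz, fun i => i.elim0⟩
  | succ k ih =>
    -- Choose a direction `v` whose width is minimal up to a factor `3 / 2`.
    obtain ⟨L, hL, hwL, v, hv, hvL⟩ : ∃ L : ℝ, 2 * 24 ^ (k + 1) ≤ L ∧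
        (∀ v : Fin (k + 1) → ℤ, v ≠ 0 → ∃ x ∈ K, ∃ y ∈ K, L ≤ intForm v x - intForm v y) ∧
        ∃ v : Fin (k + 1) → ℤ, v ≠ 0 ∧
          ∀ x ∈ K, ∀ y ∈ K, intForm v x - intForm v y < 3 / 2 * L := by
      obtain ⟨R, hR⟩ := hK.isBounded.exists_norm_le
      let M : ℕ → ℝ := fun j => (3 / 2) ^ j * (2 * 24 ^ (k + 1))
      let P : ℕ → Prop := fun j => ∃ v : Fin (k + 1) → ℤ, v ≠ 0 ∧
        ∀ x ∈ K, ∀ y ∈ K, intForm v x - intForm v y < M j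
      have hP : ∃ j, P j := by
        obtain ⟨j, hj⟩ := pow_unbounded_of_one_lt (2 * R) (by norm_num : (1 : ℝ) < 3 / 2)
        refine ⟨j, Pi.single 0 1, by simp, fun x hx y hy => ?_⟩
        have hcoord : ∀ x : Fin (k + 1) → ℝ, intForm (Pi.single 0 1) x = x 0 := fun x => by
          simp [intForm_apply, Pi.single_apply]
        have h₁ := abs_le.1 ((norm_le_pi_norm x 0).trans (hR x hx))
        have h₂ := abs_le.1 ((norm_le_pi_norm y 0).trans (hR y hy))
        have h₃ : (1 : ℝ) ≤ 24 ^ (k + 1) := one_le_pow₀ (by norm_num)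
        have h₄ : (3 / 2 : ℝ) ^ j ≤ M j := le_mul_of_one_le_right (by positivity) (by linarith)
        rw [hcoord, hcoord]
        linarith [h₁.1, h₁.2, h₂.1, h₂.2]
      classical
      obtain ⟨j, hj⟩ : ∃ j, Nat.find hP = j + 1 := by
        refine Nat.exists_eq_succ_of_ne_zero fun h => ?_
        obtain ⟨v, hv, hvw⟩ := h ▸ Nat.find_spec hP
        obtain ⟨x, hx, y, hy, hxy⟩ := hw v hv
        have := hvw x hx y hy
        simp only [M, pow_zero, one_mul] at this
        linarith
      refine ⟨M j, le_mul_of_one_le_left (by positivity) (one_le_pow₀ (by norm_num)),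
        fun v hv => ?_, ?_⟩
      · have hnot := Nat.find_min hP (show j < Nat.find hP by omega)
        by_contra! hcon
        exact hnot ⟨v, hv, hcon⟩
      · obtain ⟨v, hv, hvw⟩ := hj ▸ Nat.find_spec hP
        refine ⟨v, hv, fun x hx y hy => (hvw x hx y hy).trans_le (le_of_eq ?_)⟩
        simp only [M, pow_succ]
        ring
    obtain ⟨g, u, e, hg, rfl, hue⟩ := exists_smul_primitive hv
    obtain ⟨T, hT0, hT⟩ := exists_unimodular hue
    have hL0 : (2 : ℝ) ≤ L := by
      have h₃ : (1 : ℝ) ≤ 24 ^ (k + 1) := one_le_pow₀ (by norm_num)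
      linarith
    have hTc : Continuous T := LinearMap.continuous_of_finiteDimensional T.toLinearMap
    have hKT : IsCompact (T '' K) := hK.image hTc
    have hcT : Convex ℝ (T '' K) := hconv.linear_image T.toLinearMap
    obtain ⟨n, hn, hwn⟩ := exists_wide_slice hKT hcT hL0
      (fun a ha => by
        obtain ⟨b, hb⟩ := exists_eq_intForm (intForm a ∘ₗ T.toLinearMap)
          fun z hz => ((hT z).2 hz).exists_intForm_eq a
        have hb' : ∀ z, intForm a (T z) = intForm b z := fun z => LinearMap.congr_fun hb z
        have hb0 : b ≠ 0 := by
          rintro rfl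
          obtain ⟨i, hi⟩ := Function.ne_iff.1 ha
          have := hb' (T.symm (Pi.single i 1))
          rw [T.apply_symm_apply, intForm_single] at this
          refine hi ?_
          simpa [intForm_apply] using this
        obtain ⟨x, hx, y, hy, hxy⟩ := hwL b hb0
        refine ⟨_, ⟨x, hx, rfl⟩, _, ⟨y, hy, rfl⟩, ?_⟩
        rwa [hb', hb'])
      (by
        rintro _ ⟨x, hx, rfl⟩ _ ⟨y, hy, rfl⟩
        rw [hT0, hT0]
        have h₁ := hvL x hx y hy
        have h₂ := hvL y hy x hx
        rw [intForm_smul] at h₁ h₂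
        simp only [LinearMap.smul_apply, smul_eq_mul] at h₁ h₂
        have h₃ : |(g : ℝ)| * |intForm u x - intForm u y| ≤ 3 / 2 * L := by
          rw [← abs_mul, abs_le]
          constructor <;> linarith
        have h₄ : (1 : ℝ) ≤ |(g : ℝ)| := by exact_mod_cast Int.one_le_abs hg
        exact (le_abs_self _).trans ((le_mul_of_one_le_left (abs_nonneg _) h₄).trans h₃))
    have hslice : IsCompact {y | (Fin.cons (n : ℝ) y : Fin (k + 1) → ℝ) ∈ T '' K} := by
      have h₁ : IsCompact (T '' K ∩ {z | z 0 = n}) :=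
        hKT.inter_right (isClosed_eq (continuous_apply 0) continuous_const)
      have h₂ : Continuous (Fin.tail : (Fin (k + 1) → ℝ) → Fin k → ℝ) :=
        continuous_pi fun i => continuous_apply i.succ
      convert h₁.image h₂ using 1
      ext y
      constructor
      · exact fun hy => ⟨_, ⟨hy, rfl⟩, Fin.tail_cons _ _⟩
      · rintro ⟨z, ⟨hz, hz0⟩, rfl⟩
        rw [Set.mem_ofPred_eq] at hz0
        rwa [Set.mem_ofPred_eq, ← hz0, Fin.cons_self_tail]
    obtain ⟨z, hz, hzl⟩ := ih (K := {y | (Fin.cons (n : ℝ) y : Fin (k + 1) → ℝ) ∈ T '' K})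
      hslice
      (fun a ha b hb s t hs ht hst => by
        have := hcT ha hb hs ht hst
        rw [Set.mem_ofPred_eq]
        convert this using 1
        funext i
        refine Fin.cases ?_ (fun i => ?_) i
        · simp [← add_mul, hst]
        · simp) hn
      (fun a ha => by
        obtain ⟨y, hy, y', hy', h⟩ := hwn a ha
        refine ⟨y, hy, y', hy', le_trans ?_ h⟩
        rw [pow_succ] at hL
        linarith)
    obtain ⟨x, hx, hxz⟩ := hz
    refine ⟨x, hx, (hT x).1 ?_⟩
    rw [hxz, isLatticePoint_succ_iff]
    exact ⟨⟨n, rfl⟩, by simpa using hzl⟩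

lemma sum_mul_sub_eq_intForm {k : ℕ} (v : Fin k → ℤ) (x y : Fin k → ℝ) :
    ∑ i, (v i : ℝ) * (x i - y i) = intForm v x - intForm v y := by
  rw [← map_sub, intForm_apply]
  rfl

lemma ofReal_le_latticeWidth {k : ℕ} {B : Set (Fin k → ℝ)} {w : ℝ}
    (h : ∀ v : Fin k → ℤ, v ≠ 0 → ∃ x ∈ B, ∃ y ∈ B, w ≤ intForm v x - intForm v y) :
    ENNReal.ofReal w ≤ latticeWidth B := by
  refine le_iInf₂ fun v hv => ?_
  obtain ⟨x, hx, y, hy, hxy⟩ := h v hv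
  refine le_iSup₂_of_le x hx (le_iSup₂_of_le y hy (ENNReal.ofReal_le_ofReal ?_))
  rwa [sum_mul_sub_eq_intForm]

lemma exists_lt_of_ofReal_lt_latticeWidth {k : ℕ} {B : Set (Fin k → ℝ)} {w : ℝ}
    (h : ENNReal.ofReal w < latticeWidth B) {v : Fin k → ℤ} (hv : v ≠ 0) :
    ∃ x ∈ B, ∃ y ∈ B, w < intForm v x - intForm v y := by
  have := h.trans_le (iInf₂_le v hv)
  simp only [lt_iSup_iff, sum_mul_sub_eq_intForm] at this
  obtain ⟨x, hx, y, hy, hxy⟩ := this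
  exact ⟨x, hx, y, hy, lt_of_not_ge fun hle => hxy.not_ge (ENNReal.ofReal_le_ofReal hle)⟩

lemma latticeWidth_le_flatnessConst {k : ℕ} {B : Set (Fin k → ℝ)} (hB : Convex ℝ B)
    (hcl : IsClosed B) (hspan : affineSpan ℝ B = ⊤) (hfree : ∀ x ∈ B, ¬ IsLatticePoint x) :
    latticeWidth B ≤ flatnessConst k :=
  le_iSup₂_of_le (f := fun B _ => latticeWidth B) B ⟨hB, hcl, hspan, hfree⟩ le_rfl

lemma flatnessConst_ne_top (k : ℕ) : flatnessConst k ≠ ⊤ := by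
  refine ne_top_of_le_ne_top (ENNReal.ofReal_ne_top (r := 2 * 24 ^ k)) (iSup₂_le ?_)
  rintro B ⟨hconv, hcl, hspan, hfree⟩
  by_contra! hlt
  set w : ℝ := 2 * 24 ^ k
  obtain ⟨c, hc⟩ := hconv.interior_nonempty_iff_affineSpan_eq_top.2 hspan
  obtain ⟨r, hr, hball⟩ := Metric.nhds_basis_closedBall.mem_iff.1 (mem_interior_iff_mem_nhds.1 hc)
  obtain ⟨N, hN⟩ := exists_nat_ge (w / r)
  rw [div_le_iff₀ hr] at hN
  -- Only finitely many directions are not witnessed by the ball around `c`.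
  have hfin : (Set.Icc (fun _ => -(N : ℤ)) (fun _ => (N : ℤ)) : Set (Fin k → ℤ)).Finite :=
    Set.finite_Icc _ _
  have hev : ∀ᶠ R : ℝ in Filter.atTop, ∀ v ∈ Set.Icc (fun _ => -(N : ℤ)) (fun _ => (N : ℤ)),
      v ≠ 0 → ∃ x ∈ B ∩ Metric.closedBall 0 R, ∃ y ∈ B ∩ Metric.closedBall 0 R,
        w ≤ intForm v x - intForm v y := by
    refine hfin.eventually_all.2 fun v _ => ?_
    by_cases hv : v = 0
    · exact Filter.Eventually.of_forall fun R h => absurd hv h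
    obtain ⟨x, hx, y, hy, hxy⟩ := exists_lt_of_ofReal_lt_latticeWidth hlt hv
    filter_upwards [Filter.eventually_ge_atTop ‖x‖, Filter.eventually_ge_atTop ‖y‖] with R h₁ h₂ _
    exact ⟨x, ⟨hx, by simpa using h₁⟩, y, ⟨hy, by simpa using h₂⟩, hxy.le⟩
  obtain ⟨R, hR, hcR⟩ := (hev.and (Filter.eventually_ge_atTop (‖c‖ + r))).exists
  have hsub : Metric.closedBall c r ⊆ B ∩ Metric.closedBall 0 R :=
    Set.subset_inter hball (Metric.closedBall_subset_closedBall' (by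
      rw [dist_zero_right]
      linarith))
  obtain ⟨z, hz, hzl⟩ := exists_isLatticePoint_of_wide k
    ((isCompact_closedBall (0 : Fin k → ℝ) R).inter_left hcl)
    (hconv.inter (convex_closedBall _ _)) ⟨c, hsub (Metric.mem_closedBall_self hr.le)⟩
    (fun v hv => by
      by_cases hvN : v ∈ Set.Icc (fun _ => -(N : ℤ)) (fun _ => (N : ℤ))
      · exact hR v hvN hv
      obtain ⟨i, hi⟩ : ∃ i, (N : ℤ) < |v i| := by
        by_contra! hcon
        exact hvN ⟨fun i => (abs_le.1 (hcon i)).1, fun i => (abs_le.1 (hcon i)).2⟩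
      obtain ⟨s, hs, hvs⟩ : ∃ s : ℝ, |s| = r ∧ (v i : ℝ) * s = |(v i : ℝ)| * r := by
        rcases le_total 0 (v i : ℝ) with h | h
        · exact ⟨r, abs_of_pos hr, by rw [abs_of_nonneg h]⟩
        · exact ⟨-r, by rw [abs_neg, abs_of_pos hr], by rw [abs_of_nonpos h]; ring⟩
      refine ⟨c + Pi.single i s, hsub ?_, c, hsub (Metric.mem_closedBall_self hr.le), ?_⟩
      · rw [mem_closedBall_iff_norm, add_sub_cancel_left, Pi.norm_single, Real.norm_eq_abs, hs]
      · rw [map_add, add_sub_cancel_left, intForm_single, hvs]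
        have : (N : ℝ) < |(v i : ℝ)| := by exact_mod_cast hi
        exact hN.trans (mul_le_mul_of_nonneg_right this.le hr.le))
  exact hfree z hz.1 hzl

/-- The flatness constant also bounds the width of lattice-free convex sets that are not
closed. -/
lemma ofReal_le_flatnessConst {k : ℕ} {B : Set (Fin k → ℝ)} (hB : Convex ℝ B)
    (hspan : affineSpan ℝ B = ⊤) (hfree : ∀ x ∈ B, ¬ IsLatticePoint x) {w : ℝ}
    (h : ∀ v : Fin k → ℤ, v ≠ 0 → ∃ x ∈ B, ∃ y ∈ B, w ≤ intForm v x - intForm v y) :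
    ENNReal.ofReal w ≤ flatnessConst k := by
  obtain ⟨c, hc⟩ := hB.interior_nonempty_iff_affineSpan_eq_top.2 hspan
  -- Shrink the closure of `B` slightly towards an interior point.
  have hshrink : ∀ t : ℝ, 1 < t → ENNReal.ofReal (w / t) ≤ flatnessConst k := by
    intro t ht
    have ht0 : t ≠ 0 := by positivity
    let η := AffineMap.homothety c t
    have hηc : Continuous η := AffineMap.continuous_of_finiteDimensional _
    have hη : ∀ z, η (AffineMap.homothety c t⁻¹ z) = z := fun z => by
      rw [← AffineMap.comp_apply, ← AffineMap.homothety_mul, mul_inv_cancel₀ ht0]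
      simp
    have hη' : ∀ z, AffineMap.homothety c t⁻¹ (η z) = z := fun z => by
      rw [← AffineMap.comp_apply, ← AffineMap.homothety_mul, inv_mul_cancel₀ ht0]
      simp
    have hconv : Convex ℝ (η ⁻¹' closure B) := hB.closure.affine_preimage η
    refine le_trans ?_ (latticeWidth_le_flatnessConst hconv (isClosed_closure.preimage hηc) ?_ ?_)
    · refine ofReal_le_latticeWidth fun v hv => ?_
      obtain ⟨x, hx, y, hy, hxy⟩ := h v hv
      refine ⟨AffineMap.homothety c t⁻¹ x, ?_, AffineMap.homothety c t⁻¹ y, ?_, ?_⟩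
      · rw [Set.mem_preimage, hη]
        exact subset_closure hx
      · rw [Set.mem_preimage, hη]
        exact subset_closure hy
      · simp only [AffineMap.homothety_apply, vsub_eq_sub, vadd_eq_add, map_add, map_smul, map_sub,
          smul_eq_mul]
        rw [div_eq_inv_mul]
        have := mul_le_mul_of_nonneg_left hxy (inv_nonneg.2 (zero_le_one.trans ht.le))
        linarith
    · rw [← hconv.interior_nonempty_iff_affineSpan_eq_top]
      refine ⟨c, mem_interior.2 ⟨η ⁻¹' interior B, Set.preimage_mono
        (interior_subset.trans subset_closure), isOpen_interior.preimage hηc, ?_⟩⟩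
      simpa [η] using hc
    · intro z hz
      obtain ⟨z', hz', hzz'⟩ := hB.closure_subset_image_homothety_interior_of_one_lt hc t ht hz
      have : z' = z := by rw [← hη' z, ← hη' z', ← hzz']
      exact hfree z (interior_subset (this ▸ hz'))
  rw [← ENNReal.ofReal_toReal (flatnessConst_ne_top k)]
  refine ENNReal.ofReal_le_ofReal ?_
  set F := (flatnessConst k).toReal
  have hF : 0 ≤ F := ENNReal.toReal_nonneg
  by_contra! hlt
  have hle := ENNReal.toReal_mono (flatnessConst_ne_top k)
    (hshrink (2 * w / (F + w)) (by rw [one_lt_div (by linarith)]; linarith))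
  have hw : 0 < w := hF.trans_lt hlt
  have heq : w / (2 * w / (F + w)) = (F + w) / 2 := by field_simp
  rw [heq, ENNReal.toReal_ofReal (by linarith)] at hle
  change (F + w) / 2 ≤ F at hle
  linarith

lemma flatnessConst_le_succ (k : ℕ) : flatnessConst k ≤ flatnessConst (k + 1) := by
  refine iSup₂_le ?_
  rintro B ⟨hconv, hcl, hspan, hfree⟩
  let τ : (Fin (k + 1) → ℝ) →ₗ[ℝ] (Fin k → ℝ) := LinearMap.funLeft ℝ ℝ Fin.succ
  have hτ : ∀ a (y : Fin k → ℝ), τ (Fin.cons a y : Fin (k + 1) → ℝ) = y := fun a y => rfl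
  have hτc : Continuous τ := LinearMap.continuous_of_finiteDimensional τ
  have hconv' : Convex ℝ (τ ⁻¹' B) := hconv.linear_preimage τ
  obtain ⟨c, hc⟩ := hconv.interior_nonempty_iff_affineSpan_eq_top.2 hspan
  refine le_trans ?_ (latticeWidth_le_flatnessConst hconv' (hcl.preimage hτc) ?_
    fun z hz hzl => hfree _ hz (isLatticePoint_succ_iff.1 hzl).2)
  · refine ENNReal.le_of_forall_nnreal_lt fun w hw => ?_
    rw [← ENNReal.ofReal_coe_nnreal] at hw ⊢
    refine ofReal_le_latticeWidth fun v hv => ?_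
    obtain ⟨a, u, rfl⟩ : ∃ (a : ℤ) (u : Fin k → ℤ), v = Fin.cons a u :=
      ⟨v 0, Fin.tail v, (Fin.cons_self_tail v).symm⟩
    by_cases ha : a = 0
    · have hu : u ≠ 0 := by
        rintro rfl
        refine hv (funext fun i => ?_)
        refine Fin.cases ?_ (fun i => ?_) i <;> simp [ha]
      obtain ⟨x, hx, y, hy, hxy⟩ := exists_lt_of_ofReal_lt_latticeWidth hw hu
      refine ⟨(Fin.cons 0 x : Fin (k + 1) → ℝ), hx, (Fin.cons 0 y : Fin (k + 1) → ℝ), hy, ?_⟩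
      rw [intForm_cons_cons, intForm_cons_cons]
      linarith
    · have ha' : (a : ℝ) ≠ 0 := by exact_mod_cast ha
      have hcB := interior_subset hc
      refine ⟨(Fin.cons (w / a) c : Fin (k + 1) → ℝ), hcB,
        (Fin.cons 0 c : Fin (k + 1) → ℝ), hcB, le_of_eq ?_⟩
      rw [intForm_cons_cons, intForm_cons_cons]
      field_simp
      ring
  · rw [← hconv'.interior_nonempty_iff_affineSpan_eq_top]
    exact ⟨(Fin.cons 0 c : Fin (k + 1) → ℝ), mem_interior.2 ⟨τ ⁻¹' interior B,
      Set.preimage_mono interior_subset, isOpen_interior.preimage hτc, hc⟩⟩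

/-- A set of lattice points that does not affinely span `ℝ^k` lies in an integral hyperplane. -/
lemma exists_intForm_eq_of_affineSpan_ne_top {k : ℕ} {S : Set (Fin k → ℝ)} (hne : S.Nonempty)
    (hS : ∀ z ∈ S, IsLatticePoint z) (hspan : affineSpan ℝ S ≠ ⊤) :
    ∃ v : Fin k → ℤ, v ≠ 0 ∧ ∀ x ∈ S, ∀ y ∈ S, intForm v x = intForm v y := by
  let ι : (Fin k → ℚ) →ₗ[ℚ] (Fin k → ℝ) := (Algebra.linearMap ℚ ℝ).compLeft (Fin k)
  let W : Submodule ℚ (Fin k → ℚ) := ((affineSpan ℝ S).direction.restrictScalars ℚ).comap ι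
  have hW : W < ⊤ := by
    refine lt_top_iff_ne_top.2 fun hW => hspan ?_
    rw [← AffineSubspace.direction_eq_top_iff_of_nonempty (hne.affineSpan ℝ), eq_top_iff,
      ← (Pi.basisFun ℝ (Fin k)).span_eq, Submodule.span_le]
    rintro _ ⟨i, rfl⟩
    have : Pi.single i (1 : ℚ) ∈ W := hW ▸ Submodule.mem_top
    have h₂ : ι (Pi.single i 1) = Pi.single i 1 := by
      funext j
      by_cases h : j = i
      · subst h
        simp [ι]
      · simp [ι, h]
    rw [Pi.basisFun_apply, ← h₂]
    exact this
  obtain ⟨f, hf, hfW⟩ := Submodule.exists_le_ker_of_lt_top W hW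
  obtain ⟨d, hd⟩ := IsLocalization.exist_integer_multiples_of_finite (nonZeroDivisors ℤ)
    fun i => f (Pi.single i 1)
  choose v hv using hd
  have hd0 : ((d : ℤ) : ℚ) ≠ 0 := by exact_mod_cast nonZeroDivisors.ne_zero d.2
  have hv' : ∀ i, (v i : ℚ) = (d : ℤ) * f (Pi.single i 1) := fun i => by
    simpa using hv i
  have hfv : ∀ w : Fin k → ℚ, ∑ i, (v i : ℚ) * w i = (d : ℤ) * f w := fun w => by
    conv_rhs => rw [LinearMap.pi_apply_eq_sum_univ f w]
    rw [Finset.mul_sum]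
    refine Finset.sum_congr rfl fun i _ => ?_
    have hsingle : (fun j => if i = j then (1 : ℚ) else 0) = Pi.single i 1 := by
      funext j
      simp [Pi.single_apply, eq_comm]
    rw [hsingle, hv', smul_eq_mul]
    ring
  refine ⟨v, ?_, fun x hx y hy => ?_⟩
  · rintro rfl
    refine hf (LinearMap.ext fun w => ?_)
    have := hfv w
    simpa [nonZeroDivisors.ne_zero d.2] using this
  · obtain ⟨a, rfl⟩ := isLatticePoint_iff_exists.1 (hS x hx)
    obtain ⟨b, rfl⟩ := isLatticePoint_iff_exists.1 (hS y hy)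
    have hmem : (fun i => (a i : ℚ) - b i) ∈ W := by
      have := AffineSubspace.vsub_mem_direction (subset_affineSpan ℝ S hx)
        (subset_affineSpan ℝ S hy)
      change ι _ ∈ (affineSpan ℝ S).direction
      convert this using 1
      funext i
      simp [ι]
    have h₀ := hfv fun i => (a i : ℚ) - b i
    rw [LinearMap.mem_ker.1 (hfW hmem), mul_zero] at h₀
    rw [← sub_eq_zero, ← sum_mul_sub_eq_intForm]
    exact_mod_cast h₀

lemma Int.exists_finset_of_forall_sub_lt {V : Set ℤ} {m : ℕ}
    (h : ∀ a ∈ V, ∀ b ∈ V, a - b < m) : ∃ W : Finset ℤ, W.card ≤ m ∧ ∀ a ∈ V, a ∈ W := by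
  classical
  rcases V.eq_empty_or_nonempty with rfl | ⟨a₀, ha₀⟩
  · exact ⟨∅, by simp, by simp⟩
  obtain ⟨a, ha, hmin⟩ := Int.exists_least_of_bdd (P := (· ∈ V))
    ⟨a₀ - m, fun z hz => by linarith [h a₀ ha₀ z hz]⟩ ⟨a₀, ha₀⟩
  refine ⟨Finset.Ico a (a + m), by simp, fun b hb => Finset.mem_Ico.2 ⟨hmin b hb, ?_⟩⟩
  linarith [h b hb a ha]

lemma relDist_le_iff {ι : Type*} {A B : Set (ι → ℝ)} {δ : ℝ} (hδ : 0 < δ) :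
    relDist A B ≤ ENNReal.ofReal δ ↔ ∀ π : (ι → ℝ) →ₗ[ℝ] ℝ, ∀ b ∈ B,
      Metric.infEDist (π b) (π '' A) ≤ ENNReal.ofReal δ * Metric.ediam (π '' A) := by
  refine iSup_le_iff.trans (forall_congr' fun π => ?_)
  have h₁ : Metric.ediam (π '' A) = ⨆ a ∈ A, ⨆ a' ∈ A, ENNReal.ofReal |π a - π a'| := by
    simp only [Metric.ediam, iSup_image, edist_dist, Real.dist_eq]
  have h₂ : ∀ b, Metric.infEDist (π b) (π '' A) = ⨅ a ∈ A, ENNReal.ofReal |π b - π a| := fun b => by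
    simp only [Metric.infEDist, iInf_image, edist_dist, Real.dist_eq]
  rw [ENNReal.div_le_iff_le_mul (Or.inr ENNReal.ofReal_ne_top)
    (Or.inr (ENNReal.ofReal_pos.2 hδ).ne'), iSup₂_le_iff, ← h₁]
  simp only [h₂]

lemma relDist_self_le {ι : Type*} (A : Set (ι → ℝ)) {δ : ℝ} (hδ : 0 < δ) :
    relDist A A ≤ ENNReal.ofReal δ :=
  (relDist_le_iff hδ).2 fun π b hb => by
    rw [Metric.infEDist_zero_of_mem (Set.mem_image_of_mem π hb)]
    exact zero_le

/-- The relative distance of convex hulls of unions is controlled by that of the pieces. -/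
lemma relDist_convexHull_biUnion_le {ι α : Type*} {V : Set α} {S R : α → Set (ι → ℝ)} {δ : ℝ}
    (hδ : 0 < δ)
    (h : ∀ n ∈ V, relDist (convexHull ℝ (S n)) (convexHull ℝ (R n)) ≤ ENNReal.ofReal δ) :
    relDist (convexHull ℝ (⋃ n ∈ V, S n)) (convexHull ℝ (⋃ n ∈ V, R n)) ≤ ENNReal.ofReal δ := by
  rw [relDist_le_iff hδ]
  intro π
  set A := convexHull ℝ (⋃ n ∈ V, S n)
  rcases eq_or_ne (Metric.ediam (π '' A)) ⊤ with htop | htop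
  · intro b _
    rw [htop, ENNReal.mul_top (ENNReal.ofReal_pos.2 hδ).ne']
    exact le_top
  have hr : ENNReal.ofReal δ * Metric.ediam (π '' A) =
      ENNReal.ofReal (δ * (Metric.ediam (π '' A)).toReal) := by
    rw [ENNReal.ofReal_mul hδ.le, ENNReal.ofReal_toReal htop]
  have hconv : Convex ℝ (π ⁻¹' Metric.cthickening (δ * (Metric.ediam (π '' A)).toReal)
      (π '' A)) :=
    (((convex_convexHull ℝ _).linear_image π).cthickening _).linear_preimage π
  have hsub : (⋃ n ∈ V, R n) ⊆ π ⁻¹' Metric.cthickening (δ * (Metric.ediam (π '' A)).toReal)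
      (π '' A) := by
    intro b hb
    obtain ⟨n, hn, hb⟩ := Set.mem_iUnion₂.1 hb
    have hmono : π '' convexHull ℝ (S n) ⊆ π '' A :=
      Set.image_mono (convexHull_mono (Set.subset_biUnion_of_mem (u := S) hn))
    rw [Set.mem_preimage, Metric.mem_cthickening_iff, ← hr]
    calc Metric.infEDist (π b) (π '' A)
        ≤ Metric.infEDist (π b) (π '' convexHull ℝ (S n)) := Metric.infEDist_anti hmono
      _ ≤ ENNReal.ofReal δ * Metric.ediam (π '' convexHull ℝ (S n)) :=
          (relDist_le_iff hδ).1 (h n hn) π b (subset_convexHull ℝ _ hb)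
      _ ≤ _ := mul_le_mul_right (Metric.ediam_mono hmono) _
  intro b hb
  rw [hr]
  exact convexHull_min hsub hconv hb

/-- If `relDist A B > δ`, then some linear functional exceeds its values on `A` at a point of
`B` by more than `δ` times the variation on `A`. -/
lemma exists_gap_of_lt_relDist {ι : Type*} {A B : Set (ι → ℝ)} (hA : Convex ℝ A) {δ : ℝ}
    (hδ : 0 < δ) (h : ¬ relDist A B ≤ ENNReal.ofReal δ) :
    ∃ (π : (ι → ℝ) →ₗ[ℝ] ℝ) (m : ℝ), ∃ b ∈ B, (∀ a ∈ A, δ * m < π b - π a) ∧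
      ∀ a ∈ A, ∀ a' ∈ A, π a - π a' ≤ m := by
  rw [relDist_le_iff hδ] at h
  push Not at h
  obtain ⟨π, b, hb, hlt⟩ := h
  have htop : Metric.ediam (π '' A) ≠ ⊤ := by
    intro htop
    rw [htop, ENNReal.mul_top (ENNReal.ofReal_pos.2 hδ).ne'] at hlt
    exact not_top_lt hlt
  set m := (Metric.ediam (π '' A)).toReal
  have hm0 : 0 ≤ m := ENNReal.toReal_nonneg
  have hdiam : ∀ a ∈ A, ∀ a' ∈ A, |π a - π a'| ≤ m := fun a ha a' ha' => by
    have := Metric.edist_le_ediam_of_mem (Set.mem_image_of_mem π ha) (Set.mem_image_of_mem π ha')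
    rwa [edist_dist, Real.dist_eq, ENNReal.ofReal_le_iff_le_toReal htop] at this
  have hfar : ∀ a ∈ A, δ * m < |π b - π a| := fun a ha => by
    have := hlt.trans_le (Metric.infEDist_le_edist_of_mem (Set.mem_image_of_mem π ha))
    rw [edist_dist, Real.dist_eq, ← ENNReal.ofReal_toReal htop, ← ENNReal.ofReal_mul hδ.le] at this
    exact (ENNReal.ofReal_lt_ofReal_iff_of_nonneg (by positivity)).1 this
  by_cases hcase : ∀ a ∈ A, π a < π b
  · refine ⟨π, m, b, hb, fun a ha => ?_, fun a ha a' ha' => (le_abs_self _).trans (hdiam a ha a' ha')⟩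
    rw [← abs_of_pos (sub_pos.2 (hcase a ha))]
    exact hfar a ha
  · push Not at hcase
    obtain ⟨a₁, ha₁, hle⟩ := hcase
    have hgt : ∀ a ∈ A, π b < π a := by
      by_contra! hcon
      obtain ⟨a₂, ha₂, hle₂⟩ := hcon
      obtain ⟨a, ha, hab⟩ := (hA.linear_image π).ordConnected.out (Set.mem_image_of_mem π ha₂)
        (Set.mem_image_of_mem π ha₁) ⟨hle₂, hle⟩
      have := hfar a ha
      rw [hab, sub_self, abs_zero] at this
      exact this.not_ge (by positivity)
    refine ⟨-π, m, b, hb, fun a ha => ?_, fun a ha a' ha' => ?_⟩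
    · have := hfar a ha
      rw [abs_of_neg (sub_neg.2 (hgt a ha))] at this
      simp only [LinearMap.neg_apply]
      linarith
    · have := (abs_le.1 (hdiam a ha a' ha')).1
      simp only [LinearMap.neg_apply]
      linarith

/-- If `relDist (conv S) D > δ` for the set `S` of points of `D` with integral image, then the
image of `S` meets only few hyperplanes of some primitive integral direction. -/
lemma exists_primitive_few_values {ι : Type*} {k : ℕ} {D : Set (ι → ℝ)}
    (hD : Convex ℝ D) (σ : (ι → ℝ) →ᵃ[ℝ] (Fin (k + 1) → ℝ)) {δ : ℝ} (hδ : 0 < δ)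
    (hne : (D ∩ {x | IsLatticePoint (σ x)}).Nonempty)
    (hdist : ¬ relDist (convexHull ℝ (D ∩ {x | IsLatticePoint (σ x)})) D ≤ ENNReal.ofReal δ) :
    ∃ (u e : Fin (k + 1) → ℤ) (V : Finset ℤ), ∑ i, u i * e i = 1 ∧
      (V.card : ℝ≥0∞) ≤ 1 + ENNReal.ofReal ((1 + δ) / δ) * flatnessConst (k + 1) ∧
      ∀ x ∈ D, IsLatticePoint (σ x) → ∃ n ∈ V, intForm u (σ x) = n := by
  set S := D ∩ {x | IsLatticePoint (σ x)}
  have hSD : convexHull ℝ S ⊆ D := convexHull_min Set.inter_subset_left hD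
  obtain ⟨π, M, b, hb, hgap, hvar⟩ := exists_gap_of_lt_relDist (convex_convexHull ℝ S) hδ hdist
  set F := (flatnessConst (k + 1)).toReal
  have hF0 : 0 ≤ F := ENNReal.toReal_nonneg
  set t := δ / (1 + δ) with ht
  have ht0 : 0 < t := by positivity
  have ht1 : t ≤ 1 := by
    rw [ht, div_le_one (by positivity)]
    linarith
  set c := (1 + δ) / δ with hc
  have htc : t * c = 1 := by
    rw [ht, hc]
    field_simp
  set m := ⌊1 + c * F⌋₊
  have hc0 : 0 < c := by positivity
  have hm1 : 1 ≤ m := Nat.le_floor (by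
    push_cast
    linarith [mul_nonneg hc0.le hF0])
  have hmF : c * F < m := by linarith [Nat.lt_floor_add_one (1 + c * F)]
  have hSne : (σ '' S).Nonempty := hne.image σ
  have hdir : ∃ v : Fin (k + 1) → ℤ, v ≠ 0 ∧
      ∀ x ∈ S, ∀ y ∈ S, intForm v (σ x) - intForm v (σ y) < m := by
    by_cases hspan : affineSpan ℝ (σ '' S) = ⊤
    · by_contra! hcon
      let η : (ι → ℝ) →ᵃ[ℝ] (Fin (k + 1) → ℝ) := (AffineMap.homothety (σ b) t).comp σ
      have hη : ∀ x, η x = σ (AffineMap.homothety b t x) := fun x => by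
        simp [η, AffineMap.homothety_eq_lineMap, AffineMap.apply_lineMap]
      have hsurj : Function.Surjective (AffineMap.homothety (σ b) t) := fun z =>
        ⟨AffineMap.homothety (σ b) t⁻¹ z, by
          rw [← AffineMap.comp_apply, ← AffineMap.homothety_mul, mul_inv_cancel₀ ht0.ne']
          simp⟩
      have hspan' : affineSpan ℝ (η '' convexHull ℝ S) = ⊤ := by
        refine top_le_iff.1 ?_
        rw [← AffineMap.span_eq_top_of_surjective _ hsurj hspan, ← Set.image_comp]
        exact affineSpan_mono ℝ (Set.image_mono (subset_convexHull ℝ S))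
      have hfree : ∀ z ∈ η '' convexHull ℝ S, ¬ IsLatticePoint z := by
        rintro _ ⟨x, hx, rfl⟩ hlat
        rw [hη] at hlat
        set z := AffineMap.homothety b t x with hz
        have hzD : z ∈ D := by
          rw [hz, AffineMap.homothety_eq_lineMap]
          exact hD.lineMap_mem hb (hSD hx) ⟨ht0.le, ht1⟩
        have hzS : z ∈ convexHull ℝ S := subset_convexHull ℝ S ⟨hzD, hlat⟩
        have hπz : π z = π b + t * (π x - π b) := by
          rw [hz, AffineMap.homothety_apply, vsub_eq_sub, vadd_eq_add, map_add, map_smul, map_sub,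
            smul_eq_mul, add_comm]
        have h₁ := hgap z hzS
        have h₂ := hvar z hzS x hx
        rw [hπz] at h₁ h₂
        have h₃ : δ * (1 - t) = t := by
          rw [ht]
          field_simp
          ring
        have h₄ := mul_le_mul_of_nonneg_left h₂ hδ.le
        have h₅ : δ * (π b + t * (π x - π b) - π x) = δ * (1 - t) * (π b - π x) := by ring
        rw [h₅, h₃] at h₄
        linarith
      have hle := ofReal_le_flatnessConst (w := t * m) ((convex_convexHull ℝ S).affine_image η)
        hspan' hfree fun v hv => by
          obtain ⟨x, hx, y, hy, hxy⟩ := hcon v hv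
          refine ⟨_, ⟨x, subset_convexHull ℝ S hx, rfl⟩, _, ⟨y, subset_convexHull ℝ S hy, rfl⟩, ?_⟩
          have := mul_le_mul_of_nonneg_left hxy ht0.le
          simp only [η, AffineMap.comp_apply, AffineMap.homothety_apply, vsub_eq_sub, vadd_eq_add,
            map_add, map_smul, map_sub, smul_eq_mul]
          linarith
      have hle' := (ENNReal.ofReal_le_iff_le_toReal (flatnessConst_ne_top _)).1 hle
      have h₁ := mul_lt_mul_of_pos_left hmF ht0
      rw [← mul_assoc, htc, one_mul] at h₁
      exact h₁.not_ge hle'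
    · obtain ⟨v, hv, hconst⟩ := exists_intForm_eq_of_affineSpan_ne_top hSne (by
        rintro _ ⟨x, hx, rfl⟩
        exact hx.2) hspan
      refine ⟨v, hv, fun x hx y hy => ?_⟩
      rw [hconst _ ⟨x, hx, rfl⟩ _ ⟨y, hy, rfl⟩, sub_self]
      exact_mod_cast hm1
  obtain ⟨v, hv, hvm⟩ := hdir
  obtain ⟨g, u, e, hg, rfl, hue⟩ := exists_smul_primitive hv
  obtain ⟨V, hVcard, hV⟩ := Int.exists_finset_of_forall_sub_lt (m := m)
    (V := {n | ∃ x ∈ S, intForm u (σ x) = n}) (by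
      rintro a ⟨x, hx, hxa⟩ a' ⟨y, hy, hya⟩
      have h₁ := hvm x hx y hy
      have h₂ := hvm y hy x hx
      rw [intForm_smul] at h₁ h₂
      simp only [LinearMap.smul_apply, smul_eq_mul, hxa, hya] at h₁ h₂
      have h₃ : |g| * |a - a'| < m := by
        rw [← abs_mul, abs_lt]
        constructor
        · have : g * a' - g * a < m := by exact_mod_cast h₂
          linarith
        · have : g * a - g * a' < m := by exact_mod_cast h₁
          linarith
      exact (le_abs_self _).trans_lt
        ((le_mul_of_one_le_left (abs_nonneg _) (Int.one_le_abs hg)).trans_lt h₃))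
  refine ⟨u, e, V, hue, ?_, fun x hx hxl => ?_⟩
  · have h₁ : (V.card : ℝ) ≤ 1 + c * F :=
      (Nat.cast_le.2 hVcard).trans (Nat.floor_le (by positivity))
    rw [← ENNReal.ofReal_toReal (flatnessConst_ne_top (k + 1)), ← ENNReal.ofReal_mul hc0.le,
      ← ENNReal.ofReal_one, ← ENNReal.ofReal_add zero_le_one (by positivity),
      ← ENNReal.ofReal_natCast]
    exact ENNReal.ofReal_le_ofReal h₁
  · obtain ⟨n, hn⟩ := hxl.exists_intForm_eq u
    exact ⟨n, hV n ⟨x, ⟨hx, hxl⟩, hn⟩, hn⟩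

/-- The dividing theorem for an arbitrary index type of the domain, by induction on `k`. -/
lemma exists_affineSubspaces_relDist_le {ι : Type*} (k : ℕ) {D : Set (ι → ℝ)} (hD : Convex ℝ D)
    (σ : (ι → ℝ) →ᵃ[ℝ] (Fin k → ℝ)) {δ : ℝ} (hδ : 0 < δ) :
    ∃ 𝓗 : Finset (AffineSubspace ℝ (ι → ℝ)),
      (𝓗.card : ℝ≥0∞) ≤ (1 + ENNReal.ofReal ((1 + δ) / δ) * flatnessConst k) ^ k ∧
      convexHull ℝ (D ∩ {x | IsLatticePoint (σ x)}) ⊆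
        convexHull ℝ (D ∩ ⋃ H ∈ 𝓗, (H : Set (ι → ℝ))) ∧
      relDist (convexHull ℝ (D ∩ {x | IsLatticePoint (σ x)}))
          (convexHull ℝ (D ∩ ⋃ H ∈ 𝓗, (H : Set (ι → ℝ)))) ≤ ENNReal.ofReal δ := by
  classical
  induction k generalizing D with
  | zero =>
    have h : {x | IsLatticePoint (σ x)} = Set.univ := Set.eq_univ_of_forall fun x i => i.elim0
    refine ⟨{⊤}, by simp, ?_, ?_⟩
    · simp [h]
    · simpa [h] using relDist_self_le _ hδ
  | succ k ih =>
    rcases (D ∩ {x | IsLatticePoint (σ x)}).eq_empty_or_nonempty with hemp | hne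
    · refine ⟨∅, by simp, ?_, ?_⟩
      · simp [hemp]
      · simpa [hemp] using relDist_self_le _ hδ
    by_cases hdist :
        relDist (convexHull ℝ (D ∩ {x | IsLatticePoint (σ x)})) D ≤ ENNReal.ofReal δ
    · refine ⟨{⊤}, ?_, ?_, ?_⟩
      · simpa using one_le_pow₀ (M₀ := ℝ≥0∞) le_self_add
      · simpa using convexHull_mono Set.inter_subset_left
      · simpa [hD.convexHull_eq] using hdist
    obtain ⟨u, e, V, hue, hVcard, hV⟩ := exists_primitive_few_values hD σ hδ hne hdist
    obtain ⟨T, hT0, hT⟩ := exists_unimodular hue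
    -- The hyperplanes slicing `D`, and the restriction of `σ` to them.
    let Q : ℤ → AffineSubspace ℝ (ι → ℝ) := fun n =>
      (AffineSubspace.mk' (n : ℝ) ⊥).comap ((intForm u).toAffineMap.comp σ)
    have hQ : ∀ n x, x ∈ Q n ↔ intForm u (σ x) = n := fun n x => by
      simp [Q, AffineSubspace.mem_comap, AffineSubspace.mem_mk', sub_eq_zero]
    let τ : (ι → ℝ) →ᵃ[ℝ] (Fin k → ℝ) :=
      ((LinearMap.funLeft ℝ ℝ Fin.succ) ∘ₗ T.toLinearMap).toAffineMap.comp σ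
    have hτ : ∀ (n : ℤ) x, x ∈ Q n → (IsLatticePoint (τ x) ↔ IsLatticePoint (σ x)) := by
      intro n x hx
      rw [← hT, isLatticePoint_succ_iff, hT0, (hQ n x).1 hx]
      exact ⟨fun h => ⟨⟨n, rfl⟩, h⟩, fun h => h.2⟩
    choose 𝓗 hcard hsub hrel using fun n : ℤ => ih (D := D ∩ Q n) (hD.inter (Q n).convex) τ
    have hS : D ∩ {x | IsLatticePoint (σ x)} =
        ⋃ n ∈ (V : Set ℤ), (D ∩ Q n) ∩ {x | IsLatticePoint (τ x)} := by
      ext x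
      simp only [Set.mem_iUnion, Set.mem_inter_iff, Set.mem_ofPred_eq, SetLike.mem_coe]
      constructor
      · rintro ⟨hx, hxl⟩
        obtain ⟨n, hn, hxn⟩ := hV x hx hxl
        have hxQ := (hQ n x).2 hxn
        exact ⟨n, hn, ⟨hx, hxQ⟩, (hτ n x hxQ).2 hxl⟩
      · rintro ⟨n, -, ⟨hx, hxQ⟩, hxl⟩
        exact ⟨hx, (hτ n x hxQ).1 hxl⟩
    let 𝓚 : Finset (AffineSubspace ℝ (ι → ℝ)) := V.biUnion fun n => (𝓗 n).image (Q n ⊓ ·)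
    have hR : D ∩ ⋃ H ∈ 𝓚, (H : Set (ι → ℝ)) =
        ⋃ n ∈ (V : Set ℤ), (D ∩ Q n) ∩ ⋃ H ∈ 𝓗 n, (H : Set (ι → ℝ)) := by
      ext x
      simp only [𝓚, Set.mem_iUnion, Set.mem_inter_iff, SetLike.mem_coe, Finset.mem_biUnion,
        Finset.mem_image, exists_prop]
      constructor
      · rintro ⟨hx, _, ⟨n, hn, H, hH, rfl⟩, hxH⟩
        exact ⟨n, hn, ⟨hx, hxH.1⟩, H, hH, hxH.2⟩
      · rintro ⟨n, hn, ⟨hx, hxQ⟩, H, hH, hxH⟩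
        exact ⟨hx, _, ⟨n, hn, H, hH, rfl⟩, hxQ, hxH⟩
    refine ⟨𝓚, ?_, ?_, ?_⟩
    · have h₁ : 𝓚.card ≤ ∑ n ∈ V, (𝓗 n).card :=
        Finset.card_biUnion_le.trans (Finset.sum_le_sum fun n _ => Finset.card_image_le)
      calc (𝓚.card : ℝ≥0∞) ≤ ∑ n ∈ V, ((𝓗 n).card : ℝ≥0∞) := by exact_mod_cast h₁
        _ ≤ ∑ n ∈ V, (1 + ENNReal.ofReal ((1 + δ) / δ) * flatnessConst (k + 1)) ^ k := by
          refine Finset.sum_le_sum fun n _ => (hcard n).trans ?_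
          gcongr
          exact flatnessConst_le_succ k
        _ = V.card * (1 + ENNReal.ofReal ((1 + δ) / δ) * flatnessConst (k + 1)) ^ k := by
          rw [Finset.sum_const, nsmul_eq_mul]
        _ ≤ _ := by
          rw [pow_succ']
          gcongr
    · rw [hS, hR]
      refine convexHull_min (Set.iUnion₂_subset fun n hn => ?_) (convex_convexHull ℝ _)
      refine (subset_convexHull ℝ _).trans ((hsub n).trans (convexHull_mono ?_))
      exact Set.subset_biUnion_of_mem
        (u := fun n => (D ∩ Q n) ∩ ⋃ H ∈ 𝓗 n, (H : Set (ι → ℝ))) hn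
    · rw [hS, hR]
      exact relDist_convexHull_biUnion_le hδ fun n _ => hrel n

/-- For a convex set `D ⊆ ℝ^ℓ` and an affine map `σ : ℝ^ℓ → ℝ^k`, for every
`δ > 0` there is a family `𝓗` of at most `(1 + ((1+δ)/δ)·Flt(k))^k` affine subspaces of `ℝ^ℓ`
such that `D_σ := conv(D ∩ σ⁻¹(ℤ^k))` and `D_𝓗 := conv(D ∩ ⋃_{H ∈ 𝓗} H)` satisfy
`D_σ ⊆ D_𝓗` and `rdist(D_σ, D_𝓗) ≤ δ`. -/
theorem divide_theorem (l k : ℕ) (hl : 0 < l) (hk : 0 < k)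
    (D : Set (Fin l → ℝ)) (hD : Convex ℝ D)
    (σ : (Fin l → ℝ) →ᵃ[ℝ] (Fin k → ℝ)) (δ : ℝ) (hδ : 0 < δ) :
    ∃ 𝓗 : Finset (AffineSubspace ℝ (Fin l → ℝ)),
      (𝓗.card : ℝ≥0∞) ≤ (1 + ENNReal.ofReal ((1 + δ) / δ) * flatnessConst k) ^ k ∧
      convexHull ℝ (D ∩ {x | IsLatticePoint (σ x)}) ⊆
        convexHull ℝ (D ∩ ⋃ H ∈ 𝓗, (H : Set (Fin l → ℝ))) ∧
      relDist (convexHull ℝ (D ∩ {x | IsLatticePoint (σ x)}))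
          (convexHull ℝ (D ∩ ⋃ H ∈ 𝓗, (H : Set (Fin l → ℝ)))) ≤ ENNReal.ofReal δ := by
  exact exists_affineSubspaces_relDist_le k hD σ hδ
end

section
/- Let ℓ, k be positive integers, D ⊆ ℝ^ℓ a convex set, and σ : ℝ^ℓ → ℝ^k an affine map. If rdist(D_σ, D) = δ > 0, then there exists a finite set 𝓗 of affine subspaces of ℝ^ℓ and an affine map τ : ℝ^ℓ → ℝ^{k−1} satisfying: (i) |𝓗| ≤ 1 + ((1+δ)/δ)·Flt(k); (ii) D ∩ σ⁻¹(ℤ^k) ⊆ ⋃_{H∈𝓗} H; and (iii) H ∩ σ⁻¹(ℤ^k) = H ∩ τ⁻¹(ℤ^{k−1}) for each H ∈ 𝓗. -/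
open scoped ENNReal Pointwise

open scoped Matrix

/-- Every nonzero integer vector is a positive multiple of a primitive one. -/
lemma exists_primitive_vector {k : ℕ} {z : Fin k → ℤ} (hz : z ≠ 0) :
    ∃ (g : ℤ) (u w : Fin k → ℤ), 0 < g ∧ z = g • u ∧ w ⬝ᵥ u = 1 := by
  obtain ⟨g, hg⟩ := (IsPrincipalIdealRing.principal (Ideal.span (Set.range z))).principal
  have key : ∀ g : ℤ, Ideal.span (Set.range z) = Ideal.span {g} → 0 < g →
      ∃ (g : ℤ) (u w : Fin k → ℤ), 0 < g ∧ z = g • u ∧ w ⬝ᵥ u = 1 := by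
    intro g hg hpos
    have hdvd : ∀ i, ∃ c, z i = g * c := fun i => by
      have : z i ∈ Ideal.span {g} := hg ▸ Ideal.subset_span ⟨i, rfl⟩
      exact Ideal.mem_span_singleton.1 this
    choose u hu using hdvd
    have hmem : g ∈ Ideal.span (Set.range z) := hg ▸ Ideal.mem_span_singleton_self g
    obtain ⟨w, hw⟩ := Ideal.mem_span_range_iff_exists_fun.1 hmem
    refine ⟨g, u, w, hpos, funext fun i => by simp [hu], ?_⟩
    have : g * (w ⬝ᵥ u) = g * 1 := by
      rw [mul_one, dotProduct, Finset.mul_sum]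
      conv_rhs => rw [← hw]
      exact Finset.sum_congr rfl fun i _ => by rw [hu]; ring
    exact mul_left_cancel₀ hpos.ne' this
  change Ideal.span (Set.range z) = Ideal.span {g} at hg
  rcases lt_trichotomy g 0 with h | h | h
  · exact key (-g) (by rw [hg, Ideal.span_singleton_neg]) (by omega)
  · exfalso
    apply hz
    funext i
    have : z i ∈ Ideal.span {g} := hg ▸ Ideal.subset_span ⟨i, rfl⟩
    simpa [h] using this
  · exact key g hg h

/-- A pair `v, u` of integer vectors with `v ⬝ᵥ u = 1` splits `ℤ^k` as `ℤ^(k-1) ⊕ ℤ u`. -/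
lemma exists_unimodular_splitting {k : ℕ} {v u : Fin k → ℤ} (h : v ⬝ᵥ u = 1) :
    ∃ (M : Matrix (Fin (k - 1)) (Fin k) ℤ) (N : Matrix (Fin k) (Fin (k - 1)) ℤ),
      N * M + Matrix.vecMulVec u v = 1 ∧ M * N = 1 := by
  let f : (Fin k → ℤ) →ₗ[ℤ] ℤ := dotProductBilin ℤ ℤ v
  have hf : ∀ y, f y = v ⬝ᵥ y := fun _ => rfl
  have hsurj : LinearMap.range f = ⊤ := LinearMap.range_eq_top.2 fun c =>
    ⟨c • u, by rw [hf, dotProduct_smul, h, smul_eq_mul, mul_one]⟩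
  have hrank : Module.finrank ℤ (LinearMap.ker f) = k - 1 := by
    have := Submodule.finrank_quotient_add_finrank (LinearMap.ker f)
    rw [f.quotKerEquivRange.finrank_eq, hsurj, finrank_top, Module.finrank_self,
      Module.finrank_fin_fun] at this
    omega
  let e : LinearMap.ker f ≃ₗ[ℤ] (Fin (k - 1) → ℤ) :=
    (Module.finBasisOfFinrankEq ℤ (LinearMap.ker f) hrank).equivFun
  let P : (Fin k → ℤ) →ₗ[ℤ] LinearMap.ker f :=
    LinearMap.codRestrict _ (LinearMap.id - f.smulRight u) fun y => by
      rw [LinearMap.mem_ker, LinearMap.sub_apply, map_sub, LinearMap.id_apply,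
        LinearMap.smulRight_apply, map_smul, hf u, h, smul_eq_mul, mul_one, sub_self]
  have hP : ∀ y, (P y : Fin k → ℤ) = y - f y • u := fun _ => rfl
  have hP' : ∀ y : LinearMap.ker f, P y = y := fun y => by
    ext1
    rw [hP, LinearMap.mem_ker.1 y.2, zero_smul, sub_zero]
  refine ⟨LinearMap.toMatrix' (e.toLinearMap ∘ₗ P),
    LinearMap.toMatrix' ((LinearMap.ker f).subtype ∘ₗ e.symm.toLinearMap), ?_, ?_⟩
  · rw [← LinearMap.toMatrix'_comp]
    apply Matrix.toLin'.injective
    rw [map_add, Matrix.toLin'_toMatrix', Matrix.toLin'_one]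
    refine LinearMap.ext fun y => ?_
    simp [hP, Matrix.vecMulVec_mulVec, hf]
  · rw [← LinearMap.toMatrix'_comp]
    apply Matrix.toLin'.injective
    rw [Matrix.toLin'_toMatrix', Matrix.toLin'_one]
    refine LinearMap.ext fun y => ?_
    simp [hP']

lemma isLatticePoint_iff {k : ℕ} {z : Fin k → ℝ} :
    IsLatticePoint z ↔ ∃ c : Fin k → ℤ, z = Int.cast ∘ c :=
  ⟨fun h => by choose c hc using h; exact ⟨c, funext hc⟩,
    by rintro ⟨c, rfl⟩ i; exact ⟨c i, rfl⟩⟩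

lemma intCast_mulVec {m n : ℕ} (M : Matrix (Fin m) (Fin n) ℤ) (c : Fin n → ℤ) :
    M.map (Int.cast : ℤ → ℝ) *ᵥ (Int.cast ∘ c) = Int.cast ∘ (M *ᵥ c) :=
  funext fun i => ((Int.castRingHom ℝ).map_mulVec M c i).symm

lemma IsLatticePoint.mulVec {m n : ℕ} (M : Matrix (Fin m) (Fin n) ℤ) {z : Fin n → ℝ}
    (hz : IsLatticePoint z) : IsLatticePoint (M.map (Int.cast : ℤ → ℝ) *ᵥ z) := by
  obtain ⟨c, rfl⟩ := isLatticePoint_iff.1 hz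
  exact isLatticePoint_iff.2 ⟨_, intCast_mulVec M c⟩

lemma intCast_dotProduct {k : ℕ} (v c : Fin k → ℤ) :
    ((Int.cast ∘ v : Fin k → ℝ)) ⬝ᵥ (Int.cast ∘ c) = ((v ⬝ᵥ c : ℤ) : ℝ) := by
  simp [dotProduct]

lemma exists_unimodular_splitting_real {k : ℕ} {v u : Fin k → ℤ} (h : v ⬝ᵥ u = 1) :
    ∃ (M : Matrix (Fin (k - 1)) (Fin k) ℤ) (N : Matrix (Fin k) (Fin (k - 1)) ℤ),
      (∀ y, N.map (Int.cast : ℤ → ℝ) *ᵥ (M.map (Int.cast : ℤ → ℝ) *ᵥ y) +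
        ((Int.cast ∘ v : Fin k → ℝ) ⬝ᵥ y) • (Int.cast ∘ u) = y) ∧
      ∀ c, M.map (Int.cast : ℤ → ℝ) *ᵥ (N.map (Int.cast : ℤ → ℝ) *ᵥ c) = c := by
  obtain ⟨M, N, h₁, h₂⟩ := exists_unimodular_splitting h
  have hmap : ∀ {a b c : ℕ} (P : Matrix (Fin a) (Fin b) ℤ) (Q : Matrix (Fin b) (Fin c) ℤ),
      P.map (Int.cast : ℤ → ℝ) * Q.map (Int.cast : ℤ → ℝ) = (P * Q).map (Int.cast : ℤ → ℝ) :=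
    fun P Q => (Matrix.map_mul (f := Int.castRingHom ℝ)).symm
  refine ⟨M, N, fun y => ?_, fun c => ?_⟩
  · have : (N * M).map (Int.cast : ℤ → ℝ) +
        Matrix.vecMulVec (Int.cast ∘ u : Fin k → ℝ) (Int.cast ∘ v) = 1 := by
      ext i j
      have := congrArg (Int.cast : ℤ → ℝ) (congrFun (congrFun h₁ i) j)
      simpa [Matrix.vecMulVec_apply, Matrix.one_apply, apply_ite (Int.cast : ℤ → ℝ)] using this
    conv_rhs => rw [← Matrix.one_mulVec y, ← this, Matrix.add_mulVec, Matrix.vecMulVec_mulVec]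
    rw [Matrix.mulVec_mulVec, hmap, op_smul_eq_smul]
  · rw [Matrix.mulVec_mulVec, hmap, h₂, Matrix.map_one _ Int.cast_zero Int.cast_one,
      Matrix.one_mulVec]

/-- Every ray passes arbitrarily close to a nonzero integer vector. -/
lemma exists_int_near_ray {k : ℕ} {r : Fin k → ℝ} (hr : r ≠ 0) {ε : ℝ} (hε : 0 < ε) :
    ∃ (z : Fin k → ℤ) (t : ℝ), z ≠ 0 ∧ 0 ≤ t ∧ ‖(Int.cast ∘ z : Fin k → ℝ) - t • r‖ < ε := by
  have hr' : 0 < ‖r‖ := norm_pos_iff.2 hr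
  let s : ℝ := ε / ‖r‖
  have hs : 0 < s := by positivity
  let f : ℕ → Fin k → ℝ := fun n i => Int.fract (n * s * r i)
  have hf : ∀ n, f n ∈ Set.Icc (0 : Fin k → ℝ) 1 := fun n =>
    ⟨fun i => Int.fract_nonneg _, fun i => (Int.fract_lt_one _).le⟩
  obtain ⟨a, -, φ, hφ, hlim⟩ := isCompact_Icc.tendsto_subseq hf
  obtain ⟨n₀, hn₀⟩ := Metric.cauchySeq_iff.1 hlim.cauchySeq ε hε
  have hlt : φ n₀ < φ (n₀ + 1) := hφ (Nat.lt_succ_self _)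
  have hd := hn₀ (n₀ + 1) (Nat.le_succ _) n₀ le_rfl
  rw [dist_eq_norm] at hd
  have hcast : (1 : ℝ) ≤ (φ (n₀ + 1) : ℝ) - φ n₀ := by
    have : ((φ n₀ + 1 : ℕ) : ℝ) ≤ φ (n₀ + 1) := Nat.cast_le.2 hlt
    push_cast at this
    linarith
  let z : Fin k → ℤ := fun i => ⌊φ (n₀ + 1) * s * r i⌋ - ⌊φ n₀ * s * r i⌋
  have hz : (Int.cast ∘ z : Fin k → ℝ) - (((φ (n₀ + 1) : ℝ) - φ n₀) * s) • r
      = -((f ∘ φ) (n₀ + 1) - (f ∘ φ) n₀) := by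
    funext i
    simp only [z, f, Function.comp_apply, Pi.sub_apply, Pi.neg_apply, Pi.smul_apply, smul_eq_mul,
      Int.fract, Int.cast_sub]
    ring
  refine ⟨z, ((φ (n₀ + 1) : ℝ) - φ n₀) * s, fun h0 => ?_, by nlinarith, by rwa [hz, norm_neg]⟩
  rw [← norm_neg, ← hz, h0] at hd
  have hz0 : (Int.cast ∘ (0 : Fin k → ℤ) : Fin k → ℝ) = 0 := by funext i; simp
  rw [hz0, zero_sub, norm_neg, norm_smul, Real.norm_of_nonneg (by nlinarith), mul_assoc,
    div_mul_cancel₀ _ hr'.ne'] at hd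
  nlinarith

/-- An open convex lattice-free set has finite width in some integer direction. -/
lemma exists_bounded_int_direction {k : ℕ} {K : Set (Fin k → ℝ)} (hK : Convex ℝ K)
    (hKo : IsOpen K) (hKne : K.Nonempty) (hfree : ∀ x ∈ K, ¬ IsLatticePoint x) :
    ∃ v : Fin k → ℤ, v ≠ 0 ∧ ∃ C : ℝ, ∀ x ∈ K, ∀ y ∈ K,
      (Int.cast ∘ v : Fin k → ℝ) ⬝ᵥ (x - y) ≤ C := by
  induction k with
  | zero =>
    obtain ⟨x, hx⟩ := hKne
    exact (hfree x hx fun i => i.elim0).elim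
  | succ k ih =>
    by_cases hb : Bornology.IsBounded K
    · obtain ⟨C, hC⟩ := Metric.isBounded_iff.1 hb
      refine ⟨Pi.single 0 1, by simp, C, fun x hx y hy => ?_⟩
      have h1 : (Int.cast ∘ (Pi.single 0 1 : Fin (k + 1) → ℤ) : Fin (k + 1) → ℝ)
          = Pi.single 0 1 := by
        funext i
        by_cases hi : i = 0 <;> simp [hi]
      rw [h1, single_dotProduct, one_mul]
      exact (le_abs_self _).trans ((norm_le_pi_norm (x - y) 0).trans
        ((dist_eq_norm x y).ge.trans (hC hx hy)))
    · obtain ⟨r, hr, hrK⟩ := not_bounded_iff_exists_ne_zero_mem_asymptoticCone.1 hb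
      obtain ⟨p, hp⟩ := hKne
      obtain ⟨ε, hε, hball⟩ := Metric.isOpen_iff.1 hKo p hp
      obtain ⟨z, t, hz, ht, hzt⟩ := exists_int_near_ray hr (half_pos hε)
      obtain ⟨g, u, w, hg, hzu, hwu⟩ := exists_primitive_vector hz
      have hg1 : (1 : ℝ) ≤ g := by exact_mod_cast hg
      have hseg : ∀ x ∈ K, ∀ θ : ℝ, 0 ≤ θ → θ ≤ 1 →
          ((1 / 2 : ℝ) • x + (1 / 2 : ℝ) • p) + θ • (Int.cast ∘ u : Fin (k + 1) → ℝ) ∈ K := by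
        intro x hx θ h0 h1
        have hcz : (Int.cast ∘ z : Fin (k + 1) → ℝ) = (g : ℝ) • (Int.cast ∘ u) := by
          funext i
          simp [hzu]
        set e : Fin (k + 1) → ℝ := (Int.cast ∘ z : Fin (k + 1) → ℝ) - t • r with he
        have hθ : 0 ≤ θ / g := by positivity
        have hθ1 : θ / g ≤ 1 := (div_le_one (by linarith)).2 (h1.trans hg1)
        have hm1 := hK.smul_vadd_mem_of_mem_nhds_of_mem_asymptoticCone
          (c := 2 * (θ / g) * t) (by positivity) (hKo.mem_nhds hx) hrK
        have hm2 : p + (2 * (θ / g)) • e ∈ K := by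
          apply hball
          rw [Metric.mem_ball, dist_eq_norm, add_sub_cancel_left, norm_smul,
            Real.norm_of_nonneg (by positivity)]
          nlinarith [norm_nonneg e]
        have := hK hm1 hm2 (by norm_num : (0 : ℝ) ≤ 1 / 2) (by norm_num : (0 : ℝ) ≤ 1 / 2)
          (by norm_num)
        convert this using 1
        have hu : (Int.cast ∘ u : Fin (k + 1) → ℝ) = (1 / (g : ℝ)) • (e + t • r) := by
          rw [he, sub_add_cancel, hcz, smul_smul, one_div_mul_cancel (by linarith), one_smul]
        rw [hu, vadd_eq_add]
        module
      obtain ⟨M, N, hNM, hMN⟩ := exists_unimodular_splitting_real hwu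
      let m : (Fin (k + 1) → ℝ) →ₗ[ℝ] (Fin k → ℝ) := (M.map (Int.cast : ℤ → ℝ)).mulVecLin
      have hmsurj : Function.Surjective m := fun c => ⟨N.map Int.cast *ᵥ c, hMN c⟩
      let q : (Fin (k + 1) → ℝ) → (Fin (k + 1) → ℝ) :=
        fun x => (1 / 2 : ℝ) • x + (1 / 2 : ℝ) • p
      have hq : IsOpenMap q :=
        (isOpenMap_add_right ((1 / 2 : ℝ) • p)).comp (isOpenMap_smul₀ (by norm_num))
      have hqc : Convex ℝ (q '' K) := by
        have := (hK.smul (1 / 2 : ℝ)).translate ((1 / 2 : ℝ) • p)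
        rwa [← Set.image_smul, Set.image_image,
          show (fun x => (1 / 2 : ℝ) • p + (1 / 2 : ℝ) • x) = q from funext fun x => add_comm _ _] at this
      have hfree' : ∀ c ∈ m '' (q '' K), ¬ IsLatticePoint c := by
        rintro _ ⟨_, ⟨x, hx, rfl⟩, rfl⟩ hc
        set a : ℝ := (Int.cast ∘ w : Fin (k + 1) → ℝ) ⬝ᵥ q x with ha
        have hmem := hseg x hx (⌈a⌉ - a) (sub_nonneg.2 (Int.le_ceil a))
          (by linarith [Int.ceil_lt_add_one a])
        apply hfree _ hmem
        change IsLatticePoint (q x + _)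
        rw [← hNM (q x), ← ha, add_assoc, ← add_smul, add_sub_cancel]
        obtain ⟨d, hd⟩ := isLatticePoint_iff.1 (hc.mulVec N)
        change IsLatticePoint (N.map (Int.cast : ℤ → ℝ) *ᵥ m (q x) + _)
        rw [hd]
        exact isLatticePoint_iff.2 ⟨d + ⌈a⌉ • u, by funext i; simp⟩
      obtain ⟨v, hv, C, hC⟩ := ih (hqc.linear_image m)
        (m.isOpenMap_of_finiteDimensional hmsurj _ (hq _ hKo))
        (Set.Nonempty.image _ (Set.Nonempty.image _ ⟨p, hp⟩)) hfree'
      have hvM : ∀ y, (Int.cast ∘ (v ᵥ* M) : Fin (k + 1) → ℝ) ⬝ᵥ y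
          = (Int.cast ∘ v : Fin k → ℝ) ⬝ᵥ m y := fun y => by
        rw [Matrix.mulVecLin_apply, Matrix.dotProduct_mulVec]
        congr 1
        exact funext fun i => (Int.castRingHom ℝ).map_vecMul M v i
      refine ⟨v ᵥ* M, fun h0 => hv ?_, 2 * C, fun x hx y hy => ?_⟩
      · have h0' : ∀ c : Fin k → ℝ, (Int.cast ∘ v : Fin k → ℝ) ⬝ᵥ c = 0 := fun c => by
          obtain ⟨y, rfl⟩ := hmsurj c
          rw [← hvM, h0]
          simp [dotProduct]
        funext i
        have := h0' (Pi.single i 1)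
        simpa using this
      · have := hC _ ⟨_, ⟨x, hx, rfl⟩, rfl⟩ _ ⟨_, ⟨y, hy, rfl⟩, rfl⟩
        rw [hvM]
        have hxy : m (x - y) = (2 : ℝ) • (m (q x) - m (q y)) := by
          rw [← map_sub, ← map_smul]
          congr 1
          simp only [q]
          module
        rw [hxy, dotProduct_smul, smul_eq_mul]
        linarith

/-- A convex lattice-free set with nonempty interior need not be closed to obey the flatness bound,
up to an arbitrarily small error. -/
lemma exists_flat_direction {k : ℕ} {K : Set (Fin k → ℝ)} (hK : Convex ℝ K)
    (hKi : (interior K).Nonempty) (hfree : ∀ x ∈ K, ¬ IsLatticePoint x) {ε : ℝ} (hε : 0 < ε) :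
    ∃ v : Fin k → ℤ, v ≠ 0 ∧ ∃ C : ℝ, ENNReal.ofReal C ≤ flatnessConst k + ENNReal.ofReal ε ∧
      ∀ x ∈ K, ∀ y ∈ K, (Int.cast ∘ v : Fin k → ℝ) ⬝ᵥ (x - y) ≤ C := by
  obtain ⟨p, hp⟩ := hKi
  have hshrink : ∀ t : ℝ, 0 < t → t < 1 → ∀ x ∈ closure K, (1 - t) • p + t • x ∈ interior K :=
    fun t h0 h1 x hx =>
      hK.combo_interior_closure_mem_interior hp hx (by linarith) h0.le (by ring)
  have hdot : ∀ (v : Fin k → ℝ) (t : ℝ) (x y : Fin k → ℝ),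
      v ⬝ᵥ (((1 - t) • p + t • x) - ((1 - t) • p + t • y)) = t * (v ⬝ᵥ (x - y)) := by
    intro v t x y
    rw [add_sub_add_left_eq_sub, ← smul_sub, dotProduct_smul, smul_eq_mul]
  by_cases hF : flatnessConst k = ⊤
  · obtain ⟨v, hv, C, hC⟩ := exists_bounded_int_direction hK.interior isOpen_interior ⟨p, hp⟩
      fun x hx => hfree x (interior_subset hx)
    refine ⟨v, hv, 2 * C, by simp [hF], fun x hx y hy => ?_⟩
    have := hC _ (hshrink (1 / 2) (by norm_num) (by norm_num) x (subset_closure hx))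
      _ (hshrink (1 / 2) (by norm_num) (by norm_num) y (subset_closure hy))
    rw [hdot] at this
    linarith
  · set F := (flatnessConst k).toReal
    have hF0 : 0 ≤ F := ENNReal.toReal_nonneg
    have hFeq : flatnessConst k = ENNReal.ofReal F := (ENNReal.ofReal_toReal hF).symm
    let t : ℝ := (F + ε / 2) / (F + ε)
    have ht0 : 0 < t := by positivity
    have ht1 : t < 1 := (div_lt_one (by positivity)).2 (by linarith)
    let q : (Fin k → ℝ) → (Fin k → ℝ) := fun x => (1 - t) • p + t • x
    have hq : IsOpenMap q := (isOpenMap_add_left ((1 - t) • p)).comp (isOpenMap_smul₀ ht0.ne')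
    have hqc : IsClosedMap q :=
      (isClosedMap_add_left ((1 - t) • p)).comp (isClosedMap_smul_of_ne_zero ht0.ne')
    have hconv : Convex ℝ (q '' closure K) := hK.closure.affinity _ _
    have hspan : affineSpan ℝ (q '' closure K) = ⊤ :=
      hconv.interior_nonempty_iff_affineSpan_eq_top.1 <| by
        refine Set.Nonempty.mono (interior_maximal (Set.image_mono ?_)
          (hq _ isOpen_interior)) (Set.Nonempty.image q ⟨p, hp⟩)
        exact interior_subset.trans subset_closure
    have hw : latticeWidth (q '' closure K) ≤ flatnessConst k :=
      le_iSup₂_of_le (q '' closure K) ⟨hconv, hqc _ isClosed_closure, hspan, by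
        rintro _ ⟨x, hx, rfl⟩
        exact hfree _ (interior_subset (hshrink t ht0 ht1 x hx))⟩ le_rfl
    have hlt : latticeWidth (q '' closure K) < ENNReal.ofReal (F + ε / 2) :=
      hw.trans_lt (by rw [hFeq, ENNReal.ofReal_lt_ofReal_iff (by positivity)]; linarith)
    obtain ⟨v, hv⟩ := iInf_lt_iff.1 hlt
    obtain ⟨hv0, hv⟩ := iInf_lt_iff.1 hv
    have hmem : ∀ x ∈ K, q x ∈ q '' closure K := fun x hx => ⟨x, subset_closure hx, rfl⟩
    refine ⟨v, hv0, F + ε, by rw [hFeq, ENNReal.ofReal_add hF0 hε.le], fun x hx y hy => ?_⟩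
    have h1 : ENNReal.ofReal ((Int.cast ∘ v : Fin k → ℝ) ⬝ᵥ (q x - q y)) ≤
        ENNReal.ofReal (F + ε / 2) := by
      refine le_trans ?_ hv.le
      refine le_iSup₂_of_le (q x) (hmem x hx) ?_
      refine le_iSup₂_of_le (q y) (hmem y hy) ?_
      exact le_rfl
    rw [ENNReal.ofReal_le_ofReal_iff (by positivity), hdot, div_mul_eq_mul_div,
      div_le_iff₀ (by positivity)] at h1
    exact le_of_mul_le_mul_left h1 (by positivity)

/-- Lattice points that do not affinely span `ℝ^k` lie in a common integer hyperplane. -/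
lemma exists_int_direction_of_affineSpan_ne_top {k : ℕ} {S : Set (Fin k → ℝ)} (hne : S.Nonempty)
    (hS : ∀ s ∈ S, IsLatticePoint s) (hspan : affineSpan ℝ S ≠ ⊤) :
    ∃ v : Fin k → ℤ, v ≠ 0 ∧ ∀ s ∈ S, ∀ s' ∈ S, (Int.cast ∘ v : Fin k → ℝ) ⬝ᵥ (s - s') = 0 := by
  let T : Set (Fin k → ℚ) :=
    {d | ∃ c c' : Fin k → ℤ, Int.cast ∘ c ∈ S ∧ Int.cast ∘ c' ∈ S ∧ d = Int.cast ∘ (c - c')}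
  have hT : Submodule.span ℚ T < ⊤ := by
    refine lt_of_le_of_ne le_top fun htop => hspan ?_
    rw [AffineSubspace.affineSpan_eq_top_iff_vectorSpan_eq_top_of_nonempty _ _ _ hne, eq_top_iff]
    have hcast : ∀ d ∈ Submodule.span ℚ T, (Rat.cast ∘ d : Fin k → ℝ) ∈ vectorSpan ℝ S := by
      intro d hd
      induction hd using Submodule.span_induction with
      | mem d hd =>
        obtain ⟨c, c', hc, hc', rfl⟩ := hd
        convert vsub_mem_vectorSpan ℝ hc hc' using 1
        funext i
        simp
      | zero => convert (vectorSpan ℝ S).zero_mem using 1; funext i; simp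
      | add x y _ _ hx hy => convert (vectorSpan ℝ S).add_mem hx hy using 1; funext i; simp
      | smul a x _ hx => convert (vectorSpan ℝ S).smul_mem (a : ℝ) hx using 1; funext i; simp
    rw [← (Pi.basisFun ℝ (Fin k)).span_eq, Submodule.span_le]
    rintro _ ⟨i, rfl⟩
    have hi : Pi.basisFun ℝ (Fin k) i = Rat.cast ∘ (Pi.single i 1 : Fin k → ℚ) := by
      funext j
      by_cases h : j = i
      · subst h; simp
      · simp [h]
    exact hi ▸ hcast (Pi.single i 1) (htop ▸ Submodule.mem_top)
  obtain ⟨f, hf, hfT⟩ := Submodule.exists_le_ker_of_lt_top _ hT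
  obtain ⟨⟨N, hN⟩, hv⟩ := IsLocalization.exist_integer_multiples_of_finite (nonZeroDivisors ℤ)
    fun i => f (Pi.single i 1)
  have hN0 : (N : ℚ) ≠ 0 := Int.cast_ne_zero.2 (nonZeroDivisors.ne_zero hN)
  choose v hv using hv
  replace hv : ∀ i, (v i : ℚ) = N * f (Pi.single i 1) := fun i => by simpa using hv i
  have hfv : ∀ d : Fin k → ℤ, ((v ⬝ᵥ d : ℤ) : ℚ) = N * f (Int.cast ∘ d) := fun d => by
    have hd : (Int.cast ∘ d : Fin k → ℚ) = ∑ i, (d i : ℚ) • Pi.single i (1 : ℚ) := by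
      simpa using pi_eq_sum_univ' (Int.cast ∘ d : Fin k → ℚ)
    rw [hd, map_sum, Finset.mul_sum, dotProduct, Int.cast_sum]
    refine Finset.sum_congr rfl fun i _ => ?_
    rw [map_smul, smul_eq_mul, Int.cast_mul, hv]
    ring
  refine ⟨v, fun h0 => hf ?_, fun s hs s' hs' => ?_⟩
  · refine (Pi.basisFun ℚ (Fin k)).ext fun i => ?_
    have := hv i
    rw [h0, Pi.zero_apply, Int.cast_zero, eq_comm, mul_eq_zero] at this
    simpa using this.resolve_left hN0
  · obtain ⟨c, rfl⟩ := isLatticePoint_iff.1 (hS s hs)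
    obtain ⟨c', rfl⟩ := isLatticePoint_iff.1 (hS s' hs')
    have hmem : f (Int.cast ∘ (c - c')) = 0 :=
      LinearMap.mem_ker.1 (hfT (Submodule.subset_span ⟨c, c', hs, hs', rfl⟩))
    have h0 : v ⬝ᵥ (c - c') = 0 := by
      have := hfv (c - c')
      rw [hmem, mul_zero] at this
      exact_mod_cast this
    rw [dotProduct_sub, intCast_dotProduct, intCast_dotProduct, ← Int.cast_sub, ← dotProduct_sub,
      h0, Int.cast_zero]

/-- A lower bound on the relative distance is witnessed by a point and a linear functional. -/
lemma exists_separated_of_lt_relDist {ι : Type*} {A B : Set (ι → ℝ)} (hA : Convex ℝ A)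
    {δ : ℝ} (hδ : 0 ≤ δ) (h : ENNReal.ofReal δ < relDist A B) :
    ∃ π : (ι → ℝ) →ₗ[ℝ] ℝ, ∃ b ∈ B, ∃ Δ : ℝ,
      (∀ a ∈ A, δ * Δ < π b - π a) ∧ ∀ a ∈ A, ∀ a' ∈ A, π a - π a' ≤ Δ := by
  obtain ⟨π, hπ⟩ := lt_iSup_iff.1 h
  set diam : ENNReal := ⨆ a ∈ A, ⨆ a' ∈ A, ENNReal.ofReal |π a - π a'|
  have htop : diam ≠ ⊤ := fun h0 => by simp [h0] at hπ
  obtain ⟨b, hπ⟩ := lt_iSup_iff.1 (ENNReal.mul_lt_of_lt_div hπ)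
  obtain ⟨hb, hπ⟩ := lt_iSup_iff.1 hπ
  have hΔ : diam = ENNReal.ofReal diam.toReal := (ENNReal.ofReal_toReal htop).symm
  have hΔ0 : 0 ≤ diam.toReal := ENNReal.toReal_nonneg
  have hdiam' : ∀ a ∈ A, ∀ a' ∈ A, |π a - π a'| ≤ diam.toReal := fun a ha a' ha' => by
    rw [← ENNReal.ofReal_le_ofReal_iff hΔ0, ← hΔ]
    exact le_iSup₂_of_le a ha (le_iSup₂_of_le a' ha' le_rfl)
  have hfar : ∀ a ∈ A, δ * diam.toReal < |π b - π a| := fun a ha => by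
    have h1 := hπ.trans_le (iInf₂_le a ha)
    rw [hΔ, ← ENNReal.ofReal_mul hδ] at h1
    exact ENNReal.ofReal_lt_ofReal_iff'.1 h1 |>.1
  have hside : (∀ a ∈ A, π a < π b) ∨ ∀ a ∈ A, π b < π a := by
    by_contra! hcon
    obtain ⟨⟨a, ha, h1⟩, a', ha', h2⟩ := hcon
    obtain ⟨c, hc, hcb⟩ := (hA.linear_image π).ordConnected.out ⟨a', ha', rfl⟩ ⟨a, ha, rfl⟩ ⟨h2, h1⟩
    have := hfar c hc
    rw [hcb, sub_self, abs_zero] at this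
    exact absurd this (not_lt.2 (by positivity))
  rcases hside with hs | hs
  · refine ⟨π, b, hb, diam.toReal, fun a ha => ?_, fun a ha a' ha' =>
      (le_abs_self _).trans (hdiam' a ha a' ha')⟩
    have := hfar a ha
    rwa [abs_of_pos (sub_pos.2 (hs a ha))] at this
  · refine ⟨-π, b, hb, diam.toReal, fun a ha => ?_, fun a ha a' ha' => ?_⟩
    · have := hfar a ha
      rw [abs_of_neg (sub_neg.2 (hs a ha))] at this
      simpa [sub_eq_add_neg, add_comm] using this
    · have := (neg_le_abs _).trans (hdiam' a ha a' ha')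
      simpa [sub_eq_add_neg, add_comm] using this

/-- Contracting `σ(D_σ)` by the factor `δ / (1 + δ)` towards a suitable point of `σ(D)`
yields a lattice-free set. -/
lemma exists_latticeFree_contraction {l k : ℕ} {D : Set (Fin l → ℝ)} (hD : Convex ℝ D)
    (σ : (Fin l → ℝ) →ᵃ[ℝ] (Fin k → ℝ)) {δ : ℝ} (hδ : 0 < δ)
    (h : ENNReal.ofReal δ < relDist (convexHull ℝ (D ∩ {x | IsLatticePoint (σ x)})) D) :
    ∃ p : Fin k → ℝ, ∀ x ∈ convexHull ℝ (σ '' (D ∩ {x | IsLatticePoint (σ x)})),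
      ¬ IsLatticePoint (p + (δ / (1 + δ)) • x) := by
  obtain ⟨π, b, hb, Δ, hfar, hΔ⟩ := exists_separated_of_lt_relDist (convex_convexHull ℝ _) hδ.le h
  have hAD : convexHull ℝ (D ∩ {x | IsLatticePoint (σ x)}) ⊆ D :=
    convexHull_min Set.inter_subset_left hD
  have hsum : 1 / (1 + δ) + δ / (1 + δ) = 1 := by field_simp
  refine ⟨(1 / (1 + δ)) • σ b, fun x hx hlat => ?_⟩
  rw [← σ.image_convexHull] at hx
  obtain ⟨a, ha, rfl⟩ := hx
  rw [← Convex.combo_affine_apply hsum] at hlat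
  have hmem := subset_convexHull ℝ (D ∩ {x | IsLatticePoint (σ x)})
    ⟨hD hb (hAD ha) (by positivity) (by positivity) hsum, hlat⟩
  have h1 := hfar _ hmem
  have h2 := hΔ _ hmem _ ha
  simp only [map_add, map_smul, smul_eq_mul] at h1 h2
  have e1 : π b - (1 / (1 + δ) * π b + δ / (1 + δ) * π a) = δ * (1 / (1 + δ) * (π b - π a)) := by
    field_simp
    ring
  have e2 : 1 / (1 + δ) * π b + δ / (1 + δ) * π a - π a = 1 / (1 + δ) * (π b - π a) := by
    field_simp
    ring
  rw [e1] at h1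
  rw [e2] at h2
  exact absurd h1 (not_lt.2 (mul_le_mul_of_nonneg_left h2 hδ.le))

/-- The lattice points of `σ(D)` lie on few parallel integer hyperplanes. -/
lemma exists_narrow_int_direction {l k : ℕ} {D : Set (Fin l → ℝ)} (hD : Convex ℝ D)
    (σ : (Fin l → ℝ) →ᵃ[ℝ] (Fin k → ℝ)) {δ : ℝ} (hδ : 0 < δ)
    (hrd : relDist (convexHull ℝ (D ∩ {x | IsLatticePoint (σ x)})) D = ENNReal.ofReal δ)
    (hne : (D ∩ {x | IsLatticePoint (σ x)}).Nonempty) :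
    ∃ v : Fin k → ℤ, v ≠ 0 ∧ ∃ w : ℕ,
      (w : ℝ≥0∞) ≤ ENNReal.ofReal ((1 + δ) / δ) * flatnessConst k ∧
      ∀ c c' : Fin k → ℤ, Int.cast ∘ c ∈ σ '' D → Int.cast ∘ c' ∈ σ '' D → v ⬝ᵥ (c - c') ≤ w := by
  set S := σ '' (D ∩ {x | IsLatticePoint (σ x)})
  have hSmem : ∀ c : Fin k → ℤ, Int.cast ∘ c ∈ σ '' D → Int.cast ∘ c ∈ S := by
    rintro c ⟨x, hx, hxc⟩
    exact ⟨x, ⟨hx, isLatticePoint_iff.2 ⟨c, hxc⟩⟩, hxc⟩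
  have hcast : ∀ v c c' : Fin k → ℤ, (Int.cast ∘ v : Fin k → ℝ) ⬝ᵥ (Int.cast ∘ c - Int.cast ∘ c')
      = ((v ⬝ᵥ (c - c') : ℤ) : ℝ) := fun v c c' => by
    rw [dotProduct_sub, intCast_dotProduct, intCast_dotProduct, dotProduct_sub, Int.cast_sub]
  by_cases hspan : affineSpan ℝ S = ⊤
  swap
  · obtain ⟨v, hv, hvS⟩ := exists_int_direction_of_affineSpan_ne_top (hne.image σ)
      (by rintro _ ⟨x, hx, rfl⟩; exact hx.2) hspan
    refine ⟨v, hv, 0, by simp, fun c c' hc hc' => ?_⟩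
    have := hvS _ (hSmem c hc) _ (hSmem c' hc')
    rw [hcast] at this
    exact_mod_cast this.le
  have key : ∃ η : ℝ, 0 < η ∧ η < δ ∧ ∀ C : ℝ,
      ENNReal.ofReal C ≤ flatnessConst k + ENNReal.ofReal η →
      ((⌊(1 + (δ - η)) / (δ - η) * C⌋₊ : ℕ) : ℝ≥0∞) ≤
        ENNReal.ofReal ((1 + δ) / δ) * flatnessConst k := by
    by_cases hF : flatnessConst k = ⊤
    · refine ⟨δ / 2, by positivity, by linarith, fun C _ => ?_⟩
      rw [hF, ENNReal.mul_top (by simpa using by positivity)]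
      exact le_top
    · set F := (flatnessConst k).toReal
      have hF0 : 0 ≤ F := ENNReal.toReal_nonneg
      have hFeq : flatnessConst k = ENNReal.ofReal F := (ENNReal.ofReal_toReal hF).symm
      have hcont : ContinuousAt (fun η : ℝ => (1 + (δ - η)) / (δ - η) * (F + η)) 0 := by
        have : δ - 0 ≠ 0 := by simpa using hδ.ne'
        fun_prop (disch := assumption)
      have hlt : (1 + (δ - 0)) / (δ - 0) * (F + 0) < (⌊(1 + δ) / δ * F⌋₊ : ℝ) + 1 := by
        simpa using Nat.lt_floor_add_one ((1 + δ) / δ * F)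
      have hev := (hcont.eventually_lt continuousAt_const hlt).filter_mono
        (nhdsWithin_le_nhds (s := Set.Ioi 0))
      obtain ⟨η, hη, hη0, hηδ⟩ := (hev.and (Ioo_mem_nhdsGT hδ)).exists
      refine ⟨η, hη0, hηδ, fun C hC => ?_⟩
      rw [hFeq, ← ENNReal.ofReal_add hF0 hη0.le, ENNReal.ofReal_le_ofReal_iff (by positivity)] at hC
      have hle : ⌊(1 + (δ - η)) / (δ - η) * C⌋₊ ≤ ⌊(1 + δ) / δ * F⌋₊ := by
        rw [← Nat.lt_add_one_iff, Nat.floor_lt' (by omega)]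
        push_cast
        refine lt_of_le_of_lt ?_ hη
        have : 0 < δ - η := sub_pos.2 hηδ
        gcongr
      rw [hFeq, ← ENNReal.ofReal_mul (by positivity), ← ENNReal.ofReal_natCast]
      exact ENNReal.ofReal_le_ofReal
        ((Nat.cast_le.2 hle).trans (Nat.floor_le (by positivity)))
  obtain ⟨η, hη0, hηδ, hfloor⟩ := key
  have hδη : 0 < δ - η := sub_pos.2 hηδ
  set s : ℝ := (δ - η) / (1 + (δ - η)) with hs
  have hs0 : 0 < s := by positivity
  obtain ⟨p, hp⟩ := exists_latticeFree_contraction hD σ hδη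
    (by rw [hrd, ENNReal.ofReal_lt_ofReal_iff hδ]; linarith)
  let q : (Fin k → ℝ) → (Fin k → ℝ) := fun x => p + s • x
  have hq : IsOpenMap q := (isOpenMap_add_left p).comp (isOpenMap_smul₀ hs0.ne')
  have hint : (interior (q '' convexHull ℝ S)).Nonempty :=
    Set.Nonempty.mono (interior_maximal (Set.image_mono interior_subset) (hq _ isOpen_interior))
      (Set.Nonempty.image q (interior_convexHull_nonempty_iff_affineSpan_eq_top.2 hspan))
  obtain ⟨v, hv, C, hC, hvC⟩ := exists_flat_direction ((convex_convexHull ℝ S).affinity p s) hint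
    (by rintro _ ⟨x, hx, rfl⟩; exact hp x hx) hη0
  refine ⟨v, hv, _, hfloor C hC, fun c c' hc hc' => ?_⟩
  have hw := hvC _ ⟨_, subset_convexHull ℝ S (hSmem c hc), rfl⟩
    _ ⟨_, subset_convexHull ℝ S (hSmem c' hc'), rfl⟩
  rw [add_sub_add_left_eq_sub, ← smul_sub, dotProduct_smul, smul_eq_mul, hcast, hs,
    div_mul_eq_mul_div, div_le_iff₀ (by positivity)] at hw
  refine (Int.le_floor.2 ?_).trans (Int.self_le_toNat _)
  rw [div_mul_eq_mul_div, le_div_iff₀ hδη]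
  linarith

/-- If `rdist(D_σ, D) = δ > 0`, then there is a finite set `𝓗` of affine
subspaces of `ℝ^ℓ` with `|𝓗| ≤ 1 + ((1+δ)/δ)·Flt(k)` covering `D ∩ σ⁻¹(ℤ^k)`, and an affine
map `τ : ℝ^ℓ → ℝ^(k-1)` with `H ∩ σ⁻¹(ℤ^k) = H ∩ τ⁻¹(ℤ^(k-1))` for each `H ∈ 𝓗`. -/
theorem elimination_lemma (l k : ℕ) (hl : 0 < l) (hk : 0 < k)
    (D : Set (Fin l → ℝ)) (hD : Convex ℝ D)
    (σ : (Fin l → ℝ) →ᵃ[ℝ] (Fin k → ℝ)) (δ : ℝ) (hδ : 0 < δ)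
    (hrd : relDist (convexHull ℝ (D ∩ {x | IsLatticePoint (σ x)})) D = ENNReal.ofReal δ) :
    ∃ (𝓗 : Finset (AffineSubspace ℝ (Fin l → ℝ)))
      (τ : (Fin l → ℝ) →ᵃ[ℝ] (Fin (k - 1) → ℝ)),
      (𝓗.card : ℝ≥0∞) ≤ 1 + ENNReal.ofReal ((1 + δ) / δ) * flatnessConst k ∧
      (D ∩ {x | IsLatticePoint (σ x)} ⊆ ⋃ H ∈ 𝓗, (H : Set (Fin l → ℝ))) ∧
      ∀ H ∈ 𝓗, (H : Set (Fin l → ℝ)) ∩ {x | IsLatticePoint (σ x)} =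
          (H : Set (Fin l → ℝ)) ∩ {x | IsLatticePoint (τ x)} := by
  classical
  rcases (D ∩ {x | IsLatticePoint (σ x)}).eq_empty_or_nonempty with hempty | hne
  · exact ⟨∅, 0, by simp, by simp [hempty], by simp⟩
  obtain ⟨v₀, hv₀, w, hw, hwD⟩ := exists_narrow_int_direction hD σ hδ hrd hne
  obtain ⟨g, v, u, hg, hgv, huv⟩ := exists_primitive_vector hv₀
  have hvD : ∀ c c' : Fin k → ℤ, Int.cast ∘ c ∈ σ '' D → Int.cast ∘ c' ∈ σ '' D →
      v ⬝ᵥ c - v ⬝ᵥ c' ≤ w := fun c c' hc hc' => by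
    have := hwD c c' hc hc'
    rw [hgv, smul_dotProduct, smul_eq_mul, dotProduct_sub] at this
    nlinarith [Int.natCast_nonneg w]
  obtain ⟨x₀, hx₀D, hx₀⟩ := hne
  obtain ⟨c₀, hc₀⟩ := isLatticePoint_iff.1 hx₀
  obtain ⟨m, ⟨c₁, hc₁, rfl⟩, hmin⟩ := Int.exists_least_of_bdd
    (P := fun j => ∃ c : Fin k → ℤ, Int.cast ∘ c ∈ σ '' D ∧ v ⬝ᵥ c = j)
    ⟨v ⬝ᵥ c₀ - w, by
      rintro _ ⟨c, hc, rfl⟩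
      linarith [hvD c₀ c ⟨x₀, hx₀D, hc₀⟩ hc]⟩
    ⟨_, c₀, ⟨x₀, hx₀D, hc₀⟩, rfl⟩
  obtain ⟨M, N, hNM, -⟩ := exists_unimodular_splitting_real ((dotProduct_comm v u).trans huv)
  let φ : (Fin l → ℝ) →ᵃ[ℝ] ℝ :=
    (dotProductBilin ℝ ℝ (Int.cast ∘ v : Fin k → ℝ)).toAffineMap.comp σ
  let H : ℤ → AffineSubspace ℝ (Fin l → ℝ) := fun j => (affineSpan ℝ {(j : ℝ)}).comap φ
  have hH : ∀ j x, x ∈ H j ↔ (Int.cast ∘ v : Fin k → ℝ) ⬝ᵥ σ x = j := fun j x => by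
    rw [AffineSubspace.mem_comap, AffineSubspace.mem_affineSpan_singleton]
    rfl
  refine ⟨(Finset.Icc (v ⬝ᵥ c₁) (v ⬝ᵥ c₁ + w)).image H,
    (M.map (Int.cast : ℤ → ℝ)).mulVecLin.toAffineMap.comp σ, ?_, ?_, ?_⟩
  · have hcard : ((Finset.Icc (v ⬝ᵥ c₁) (v ⬝ᵥ c₁ + w)).image H).card ≤ 1 + w := by
      refine Finset.card_image_le.trans ?_
      rw [Int.card_Icc]
      omega
    calc _ ≤ ((1 + w : ℕ) : ℝ≥0∞) := Nat.cast_le.2 hcard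
      _ ≤ _ := by
        push_cast
        gcongr
  · rintro x ⟨hxD, hx⟩
    obtain ⟨c, hc⟩ := isLatticePoint_iff.1 hx
    have hcD : (Int.cast ∘ c : Fin k → ℝ) ∈ σ '' D := ⟨x, hxD, hc⟩
    refine Set.mem_biUnion (Finset.mem_coe.2 (Finset.mem_image_of_mem H (a := v ⬝ᵥ c) ?_)) ?_
    · rw [Finset.mem_Icc]
      exact ⟨hmin _ ⟨c, hcD, rfl⟩, by linarith [hvD c c₁ hcD hc₁]⟩
    · exact (hH _ x).2 (by rw [hc, intCast_dotProduct])
  · intro H' hH'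
    obtain ⟨j, -, rfl⟩ := Finset.mem_image.1 hH'
    ext x
    refine and_congr_right fun hxj => ⟨fun hx => IsLatticePoint.mulVec M hx, fun hx => ?_⟩
    obtain ⟨d, hd⟩ := isLatticePoint_iff.1 (IsLatticePoint.mulVec N hx)
    have h := hNM (σ x)
    rw [(hH j x).1 hxj] at h
    change N.map (Int.cast : ℤ → ℝ) *ᵥ (M.map (Int.cast : ℤ → ℝ) *ᵥ σ x) = _ at hd
    rw [hd] at h
    exact isLatticePoint_iff.2 ⟨d + j • u, by rw [← h]; funext i; simp⟩
end

section
/- Let ℓ, k be positive integers, D ⊆ ℝ^ℓ a convex set, and σ : ℝ^ℓ → ℝ^k an affine map. If rdist(D_σ, D) = δ > 0, then width(σ(D_σ)) ≤ ((1+δ)/δ)·Flt(k). -/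
open scoped ENNReal Pointwise

/-- A family of integer vectors that does not span `ℝ^k` has a common nonzero integer normal. -/
lemma exists_int_normal_of_span_ne_top {k : ℕ} (V : Set (Fin k → ℤ))
    (hV : Submodule.span ℝ ((fun z : Fin k → ℤ => fun i => (z i : ℝ)) '' V) ≠ ⊤) :
    ∃ v : Fin k → ℤ, v ≠ 0 ∧ ∀ z ∈ V, ∑ i, v i * z i = 0 := by
  classical
  set E := Submodule.span ℝ ((fun z : Fin k → ℤ => fun i => (z i : ℝ)) '' V) with hE
  set W := Submodule.span ℚ ((fun z : Fin k → ℤ => fun i => (z i : ℚ)) '' V) with hW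
  let g : (Fin k → ℚ) →ₗ[ℚ] (Fin k → ℝ) := (Algebra.linearMap ℚ ℝ).compLeft (Fin k)
  have hgW : W ≤ (E.restrictScalars ℚ).comap g := by
    refine Submodule.span_le.2 ?_
    rintro _ ⟨z, hz, rfl⟩
    have : g (fun i => (z i : ℚ)) = fun i => (z i : ℝ) := by
      ext i
      simp [g]
    simpa [this] using Submodule.subset_span (Set.mem_image_of_mem _ hz)
  have hWtop : W < ⊤ := by
    refine lt_top_iff_ne_top.2 fun h => hV ?_
    refine eq_top_iff.2 fun x _ => ?_
    rw [pi_eq_sum_univ' x]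
    refine E.sum_mem fun i _ => E.smul_mem _ ?_
    have hi : Pi.single i (1 : ℚ) ∈ W := h ▸ Submodule.mem_top
    have hgi : g (Pi.single i 1) = Pi.single i 1 := by
      ext j
      by_cases hj : j = i <;> simp [g, hj]
    simpa [hgi] using hgW hi
  obtain ⟨f, hf, hfW⟩ := W.exists_le_ker_of_lt_top hWtop
  obtain ⟨⟨N, hN⟩, hint⟩ := IsLocalization.exist_integer_multiples_of_finite
    (nonZeroDivisors ℤ) (fun i : Fin k => f (Pi.single i 1))
  choose v hv using hint
  have hN0 : (N : ℚ) ≠ 0 := by exact_mod_cast nonZeroDivisors.ne_zero hN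
  have hv' : ∀ i, (v i : ℚ) = N * f (Pi.single i 1) := fun i => by simpa using hv i
  refine ⟨v, fun h => hf ?_, fun z hz => ?_⟩
  · refine LinearMap.pi_ext' fun i => LinearMap.ext_ring ?_
    have := hv' i
    simpa [h, hN0] using this
  · have h0 : f (fun i => (z i : ℚ)) = 0 :=
      hfW (Submodule.subset_span (Set.mem_image_of_mem _ hz))
    have hsum : f (fun i => (z i : ℚ)) = ∑ i, (z i : ℚ) * f (Pi.single i 1) := by
      rw [LinearMap.pi_apply_eq_sum_univ f]
      refine Finset.sum_congr rfl fun i _ => ?_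
      congr 2
      ext j
      simp [Pi.single_apply, eq_comm]
    have : ((∑ i, v i * z i : ℤ) : ℚ) = N * f (fun i => (z i : ℚ)) := by
      rw [hsum, Finset.mul_sum]
      push_cast
      refine Finset.sum_congr rfl fun i _ => ?_
      rw [hv']
      ring
    rw [h0, mul_zero] at this
    exact_mod_cast this

/-- The convex hull of a nonempty set of lattice points has lattice width zero if it is not
full-dimensional. -/
lemma latticeWidth_convexHull_eq_zero {k : ℕ} {L : Set (Fin k → ℝ)}
    (hL : ∀ x ∈ L, IsLatticePoint x) (hne : L.Nonempty) (hspan : affineSpan ℝ L ≠ ⊤) :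
    latticeWidth (convexHull ℝ L) = 0 := by
  obtain ⟨p, hp⟩ := hne
  let V : Set (Fin k → ℤ) := {z | p + (fun i => (z i : ℝ)) ∈ L}
  obtain ⟨v, hv0, hv⟩ : ∃ v : Fin k → ℤ, v ≠ 0 ∧ ∀ z ∈ V, ∑ i, v i * z i = 0 := by
    refine exists_int_normal_of_span_ne_top V fun h => hspan ?_
    rw [AffineSubspace.affineSpan_eq_top_iff_vectorSpan_eq_top_of_nonempty ℝ _ _ ⟨p, hp⟩,
      eq_top_iff, ← h, Submodule.span_le]
    rintro _ ⟨z, hz, rfl⟩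
    simpa using vsub_mem_vectorSpan ℝ (show p + (fun i => (z i : ℝ)) ∈ L from hz) hp
  let φ : (Fin k → ℝ) →ₗ[ℝ] ℝ := ∑ i, (v i : ℝ) • LinearMap.proj i
  have hφ : ∀ x, φ x = ∑ i, (v i : ℝ) * x i := fun x => by simp [φ]
  have hconst : convexHull ℝ L ⊆ {x | φ x = φ p} := by
    refine convexHull_min (fun x hx => ?_) ?_
    · choose a ha using hL x hx
      choose b hb using hL p hp
      have hz : (fun i => a i - b i) ∈ V := by
        have : p + (fun i => ((a i - b i : ℤ) : ℝ)) = x := by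
          ext i
          simp [ha, hb]
        simpa only [V, Set.mem_ofPred_eq, this] using hx
      have h0 : ((∑ i, v i * (a i - b i) : ℤ) : ℝ) = 0 := by exact_mod_cast hv _ hz
      rw [Set.mem_ofPred_eq, ← sub_eq_zero, ← map_sub, hφ, ← h0]
      simp [ha, hb]
    · exact convex_hyperplane φ.isLinear _
  refine le_antisymm (iInf₂_le_of_le v hv0 ?_) zero_le
  refine iSup₂_le fun x hx => iSup₂_le fun y hy => ?_
  have : φ (x - y) = 0 := by rw [map_sub, hconst hx, hconst hy, sub_self]
  rw [hφ] at this
  simpa using this.le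

/-- The lattice width grows at least linearly under containing a scaled translate. -/
lemma ofReal_mul_latticeWidth_le {k : ℕ} {S B : Set (Fin k → ℝ)} {s : ℝ} (hs : 0 ≤ s)
    (c : Fin k → ℝ) (h : ∀ x ∈ S, c + s • x ∈ B) :
    ENNReal.ofReal s * latticeWidth S ≤ latticeWidth B := by
  refine le_iInf₂ fun v hv => ?_
  refine (mul_le_mul_right (iInf₂_le v hv) _).trans ?_
  simp only [ENNReal.mul_iSup]
  refine iSup₂_le fun x hx => iSup₂_le fun y hy => ?_
  refine le_iSup₂_of_le _ (h x hx) (le_iSup₂_of_le _ (h y hy) ?_)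
  rw [← ENNReal.ofReal_mul hs, Finset.mul_sum]
  refine ENNReal.ofReal_le_ofReal (Finset.sum_le_sum fun i _ => le_of_eq ?_)
  simp only [Pi.add_apply, Pi.smul_apply, smul_eq_mul]
  ring

/-- If a scaled translate of a full-dimensional convex set `S` avoids the lattice, then every
smaller scaling of `S` has lattice width at most the flatness constant. -/
lemma ofReal_mul_latticeWidth_le_flatnessConst {k : ℕ} {S : Set (Fin k → ℝ)}
    (hS : Convex ℝ S) (hspan : affineSpan ℝ S = ⊤) {s u : ℝ} (hs : 0 < s) (hsu : s < u)
    (c : Fin k → ℝ) (hfree : ∀ x ∈ S, ¬ IsLatticePoint (c + u • x)) :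
    ENNReal.ofReal s * latticeWidth S ≤ flatnessConst k := by
  obtain ⟨p, hp⟩ := hS.interior_nonempty_iff_affineSpan_eq_top.2 hspan
  set c' := c + (u - s) • p with hc'
  set B : Set (Fin k → ℝ) := c' +ᵥ s • closure S with hB
  have hmem : ∀ x ∈ S, c' + s • x ∈ B := fun x hx =>
    Set.vadd_mem_vadd_set (Set.smul_mem_smul_set (subset_closure hx))
  refine (ofReal_mul_latticeWidth_le hs.le c' hmem).trans ?_
  refine le_iSup₂_of_le B ⟨(hS.closure.smul s).vadd c', ?_, ?_, ?_⟩ le_rfl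
  · exact (isClosed_closure.smul_of_ne_zero hs.ne').vadd c'
  · have hBc : Convex ℝ B := (hS.closure.smul s).vadd c'
    rw [← hBc.interior_nonempty_iff_affineSpan_eq_top, hB, interior_vadd,
      interior_smul₀ hs.ne']
    exact ⟨_, Set.vadd_mem_vadd_set
      (Set.smul_mem_smul_set (interior_mono subset_closure hp))⟩
  · rintro _ ⟨_, ⟨x, hx, rfl⟩, rfl⟩
    have hu : 0 < u := hs.trans hsu
    have hy : ((u - s) / u) • p + (s / u) • x ∈ S := interior_subset <|
      hS.combo_interior_closure_mem_interior hp hx (div_pos (sub_pos.2 hsu) hu)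
        (div_nonneg hs.le hu.le) (by field_simp; ring)
    convert hfree _ hy using 2
    ext i
    simp only [hc', vadd_eq_add, Pi.add_apply, Pi.smul_apply, smul_eq_mul]
    field_simp
    ring

/-- If the relative distance of `A` and `D` exceeds `ε`, then a shrunk copy of `A` towards some
point of `D` is disjoint from `A`. -/
lemma exists_combo_notMem_of_lt_relDist {ι : Type*} {A D : Set (ι → ℝ)} {ε : ℝ} (hε : 0 < ε)
    (h : ENNReal.ofReal ε < relDist A D) :
    ∃ b ∈ D, ∀ a ∈ A, (1 / (1 + ε)) • b + (ε / (1 + ε)) • a ∉ A := by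
  obtain ⟨π, hπ⟩ := lt_iSup_iff.1 h
  have hmul := ENNReal.mul_lt_of_lt_div hπ
  obtain ⟨b, hb⟩ := lt_iSup_iff.1 hmul
  obtain ⟨hbD, hb⟩ := lt_iSup_iff.1 hb
  refine ⟨b, hbD, fun a ha hx => hb.not_ge ?_⟩
  set x := (1 / (1 + ε)) • b + (ε / (1 + ε)) • a with hxdef
  refine (iInf₂_le x hx).trans ?_
  refine le_trans ?_ (mul_le_mul_right (le_iSup₂_of_le x hx (le_iSup₂_of_le a ha le_rfl)) _)
  rw [← ENNReal.ofReal_mul hε.le]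
  refine ENNReal.ofReal_le_ofReal (le_of_eq ?_)
  have h1 : π b - π x = ε * (π x - π a) := by
    simp only [hxdef, map_add, map_smul, smul_eq_mul]
    field_simp
    ring
  rw [h1, abs_mul, abs_of_pos hε]

/-- If `rdist(D_σ, D) = δ > 0`, then `width(σ(D_σ)) ≤ ((1+δ)/δ)·Flt(k)`. -/
theorem lattice_width_lemma (l k : ℕ) (hl : 0 < l) (hk : 0 < k)
    (D : Set (Fin l → ℝ)) (hD : Convex ℝ D)
    (σ : (Fin l → ℝ) →ᵃ[ℝ] (Fin k → ℝ)) (δ : ℝ) (hδ : 0 < δ)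
    (hrd : relDist (convexHull ℝ (D ∩ {x | IsLatticePoint (σ x)})) D = ENNReal.ofReal δ) :
    latticeWidth (σ '' convexHull ℝ (D ∩ {x | IsLatticePoint (σ x)})) ≤
      ENNReal.ofReal ((1 + δ) / δ) * flatnessConst k := by
  set T := D ∩ {x | IsLatticePoint (σ x)} with hT
  have himg : σ '' convexHull ℝ T = convexHull ℝ (σ '' T) := σ.image_convexHull T
  have hLat : ∀ x ∈ σ '' T, IsLatticePoint x := by
    rintro _ ⟨x, hx, rfl⟩
    exact hx.2
  by_cases hspan : affineSpan ℝ (σ '' T) = ⊤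
  · set S := σ '' convexHull ℝ T with hS
    have hSspan : affineSpan ℝ S = ⊤ := by rw [himg, affineSpan_convexHull, hspan]
    have hSconv : Convex ℝ S := (convex_convexHull ℝ T).affine_image σ
    have hTD : convexHull ℝ T ⊆ D := convexHull_min Set.inter_subset_left hD
    have key : ENNReal.ofReal (δ / (1 + δ)) * latticeWidth S ≤ flatnessConst k := by
      refine ENNReal.mul_le_of_forall_lt fun a ha w hw => ?_
      refine (mul_le_mul_right hw.le a).trans ?_
      lift a to NNReal using ha.ne_top
      rcases eq_or_ne a 0 with rfl | ha0
      · simp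
      have hs : (0 : ℝ) < a := by positivity
      have ha' : (a : ℝ) < δ / (1 + δ) := by
        have := (ENNReal.lt_ofReal_iff_toReal_lt ENNReal.coe_ne_top).1 ha
        simpa using this
      obtain ⟨u, hau, huδ⟩ := exists_between ha'
      have hδ1 : δ / (1 + δ) < 1 := (div_lt_one (by linarith)).2 (by linarith)
      have hu0 : 0 < u := hs.trans hau
      have hu1 : 0 < 1 - u := by linarith
      have hε : 0 < u / (1 - u) := div_pos hu0 hu1
      have hεδ : u / (1 - u) < δ := by
        rw [div_lt_iff₀ hu1]
        rw [lt_div_iff₀ (by linarith)] at huδ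
        linarith
      obtain ⟨b, hb, hbA⟩ := exists_combo_notMem_of_lt_relDist hε
        (hrd ▸ (ENNReal.ofReal_lt_ofReal_iff hδ).2 hεδ)
      have e1 : 1 / (1 + u / (1 - u)) = 1 - u := by field_simp; ring
      have e2 : u / (1 - u) / (1 + u / (1 - u)) = u := by field_simp; ring
      rw [e1, e2] at hbA
      rw [← ENNReal.ofReal_coe_nnreal]
      refine ofReal_mul_latticeWidth_le_flatnessConst hSconv hSspan hs hau ((1 - u) • σ b) ?_
      rintro _ ⟨y, hy, rfl⟩ hlat
      refine hbA y hy (subset_convexHull ℝ T ⟨?_, ?_⟩)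
      · exact hD hb (hTD hy) hu1.le hu0.le (by ring)
      · rw [Set.mem_ofPred_eq, Convex.combo_affine_apply (by ring)]
        exact hlat
    have hpos : 0 < δ / (1 + δ) := by positivity
    calc latticeWidth S
        = ENNReal.ofReal ((1 + δ) / δ) * (ENNReal.ofReal (δ / (1 + δ)) * latticeWidth S) := by
          rw [← mul_assoc, ← ENNReal.ofReal_mul (by positivity), div_mul_div_cancel₀ hδ.ne',
            div_self (by positivity), ENNReal.ofReal_one, one_mul]
      _ ≤ _ := mul_le_mul_right key _
  · have hne : (σ '' T).Nonempty := by
      rw [Set.image_nonempty, Set.nonempty_iff_ne_empty]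
      intro hempty
      obtain rfl | ⟨b, hb⟩ := D.eq_empty_or_nonempty
      · simp [relDist, hδ.not_ge, eq_comm] at hrd
      · have : ENNReal.ofReal δ = ⊤ := by
          rw [← hrd, hempty, eq_top_iff]
          refine le_iSup_of_le 0 ?_
          simp [ENNReal.top_div, biSup_const (show D.Nonempty from ⟨b, hb⟩)]
        exact ENNReal.ofReal_ne_top this
    rw [himg, latticeWidth_convexHull_eq_zero hLat hne hspan]
    exact zero_le
end

section
/- For any convex sets A ⊆ B ⊆ ℝ^d, rdist(A, B) = inf { λ ≥ 0 : B ⊆ (1+λ)·A − λ·A }, where the infimum of the empty set is ∞ and (1+λ)·A − λ·A denotes the Minkowski difference set { (1+λ)a − λa' : a, a' ∈ A }. -/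
open scoped ENNReal Pointwise

/-- Proper separation of a point from a convex set in a finite-dimensional space. -/
theorem Convex.exists_linearMap_le_of_notMem {E : Type*} [NormedAddCommGroup E] [NormedSpace ℝ E]
    [FiniteDimensional ℝ E] {s : Set E} (hs : Convex ℝ s) (hne : s.Nonempty) {x : E}
    (hx : x ∉ s) :
    ∃ f : E →ₗ[ℝ] ℝ, (∀ y ∈ s, f y ≤ f x) ∧ ∃ y ∈ s, f y < f x := by
  wlog h0 : (0 : E) ∈ s generalizing s x
  · obtain ⟨c, hc⟩ := hne
    obtain ⟨f, hf, z, hz, hzx⟩ := this (s := (fun y ↦ y + c) ⁻¹' s) (x := x - c)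
      (hs.translate_preimage_left c) ⟨0, by simpa⟩ (by simpa) (by simpa)
    refine ⟨f, fun y hy ↦ ?_, z + c, hz, ?_⟩
    · have := hf (y - c) (by simpa)
      simpa using this
    · rw [map_sub] at hzx
      rw [map_add]
      linarith
  by_cases hxs : x ∈ Submodule.span ℝ s
  · set V := Submodule.span ℝ s
    set t : Set V := (↑) ⁻¹' s with ht
    have htc : Convex ℝ t := hs.linear_preimage V.subtype
    have htspan : Submodule.span ℝ t = ⊤ := Submodule.span_span_coe_preimage
    have h0t : (0 : V) ∈ t := by simpa [ht]
    have hint : (interior t).Nonempty := by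
      rw [htc.interior_nonempty_iff_affineSpan_eq_top,
        AffineSubspace.affineSpan_eq_top_iff_vectorSpan_eq_top_of_nonempty ℝ V V ⟨0, h0t⟩,
        vectorSpan_eq_span_vsub_set_right ℝ h0t]
      simpa using htspan
    have hxt : (⟨x, hxs⟩ : V) ∉ interior t := fun h ↦ hx (interior_subset h :)
    obtain ⟨f, hf, hle⟩ := geometric_hahn_banach_of_nonempty_interior_point htc hxt hint
    obtain ⟨g, hg⟩ := (f : V →ₗ[ℝ] ℝ).exists_extend
    have hgf (v : V) : g v = f v := LinearMap.congr_fun hg v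
    have hgx : g x = f ⟨x, hxs⟩ := hgf ⟨x, hxs⟩
    have hgle : ∀ y ∈ s, g y ≤ g x := fun y hy ↦ by
      have := hle ⟨y, Submodule.subset_span hy⟩ hy
      rwa [← hgf, ← hgf] at this
    refine ⟨g, hgle, ?_⟩
    by_contra! hge
    have hconst : ∀ y ∈ s, g y = 0 := fun y hy ↦ by
      have h1 := le_antisymm (hgle y hy) (hge y hy)
      have h2 := le_antisymm (hgle 0 h0) (hge 0 h0)
      rw [map_zero] at h2
      rw [h1, h2]
    refine hf (ContinuousLinearMap.coe_injective (LinearMap.ext_on htspan fun v hv ↦ ?_))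
    simpa [hgf] using hconst v hv
  · obtain ⟨f, hfx, hf⟩ := Submodule.exists_le_ker_of_notMem hxs
    have hfs : ∀ y ∈ s, f y = 0 := fun y hy ↦ hf (Submodule.subset_span hy)
    refine ⟨f x • f, fun y hy ↦ ?_, 0, h0, ?_⟩
    · simp [hfs y hy, mul_self_nonneg]
    · simpa using hfx

/-- If `B` is contained in the blow-up of `A` by the factor `l`, the relative distance
is at most `l`. -/
theorem relDist_le_ofReal {ι : Type*} {A B : Set (ι → ℝ)} {l : ℝ} (hl : 0 ≤ l)
    (h : B ⊆ {x | ∃ a ∈ A, ∃ a' ∈ A, x = (1 + l) • a - l • a'}) :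
    relDist A B ≤ ENNReal.ofReal l := by
  refine iSup_le fun f ↦ ENNReal.div_le_of_le_mul (iSup₂_le fun b hb ↦ ?_)
  obtain ⟨a, ha, a', ha', rfl⟩ := h hb
  calc ⨅ c ∈ A, ENNReal.ofReal |f ((1 + l) • a - l • a') - f c|
      ≤ ENNReal.ofReal |f ((1 + l) • a - l • a') - f a| := iInf₂_le a ha
    _ = ENNReal.ofReal l * ENNReal.ofReal |f a - f a'| := by
      rw [← ENNReal.ofReal_mul hl, ← abs_of_nonneg hl, ← abs_mul, abs_of_nonneg hl]
      congr 2
      simp only [map_sub, map_smul, smul_eq_mul]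
      ring
    _ ≤ _ := by
      gcongr
      exact le_iSup₂_of_le a ha (le_iSup₂_of_le a' ha' le_rfl)

/-- A point of `B` outside the blow-up of `A` by the factor `l` forces the relative distance
to be at least `l`. -/
theorem ofReal_le_relDist {ι : Type*} [Fintype ι] {A B : Set (ι → ℝ)} (hA : Convex ℝ A) {l : ℝ}
    (hl : 0 ≤ l) {b : ι → ℝ} (hb : b ∈ B)
    (hbA : ¬ ∃ a ∈ A, ∃ a' ∈ A, b = (1 + l) • a - l • a') :
    ENNReal.ofReal l ≤ relDist A B := by
  obtain rfl | hl := hl.eq_or_lt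
  · simp
  obtain rfl | ⟨a₀, ha₀⟩ := A.eq_empty_or_nonempty
  · refine le_trans ?_ (le_iSup _ (0 : (ι → ℝ) →ₗ[ℝ] ℝ))
    have : (⨆ x ∈ B, ⨅ a ∈ (∅ : Set (ι → ℝ)),
        ENNReal.ofReal |(0 : (ι → ℝ) →ₗ[ℝ] ℝ) x - (0 : (ι → ℝ) →ₗ[ℝ] ℝ) a|) = ⊤ :=
      top_le_iff.1 (le_iSup₂_of_le b hb (by simp))
    rw [this, ENNReal.top_div_of_ne_top (by simp)]
    exact le_top
  have hmem {x : ι → ℝ} :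
      x ∈ (1 + l) • A - l • A ↔ ∃ a ∈ A, ∃ a' ∈ A, x = (1 + l) • a - l • a' := by
    simp only [Set.mem_sub, Set.mem_smul_set, exists_exists_and_eq_and, @eq_comm _ _ x]
  obtain ⟨f, hle, c, hc, hclt⟩ := ((hA.smul (1 + l)).sub (hA.smul l)).exists_linearMap_le_of_notMem
    ⟨_, hmem.2 ⟨a₀, ha₀, a₀, ha₀, rfl⟩⟩ (mt hmem.1 hbA)
  have hle' (p) (hp : p ∈ A) (q) (hq : q ∈ A) : (1 + l) * f p - l * f q ≤ f b := by
    simpa using hle _ (hmem.2 ⟨p, hp, q, hq, rfl⟩)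
  obtain ⟨p, hp, q, hq, rfl⟩ := hmem.1 hc
  simp only [map_sub, map_smul, smul_eq_mul] at hclt
  have key : ∀ u ∈ A, ∀ v ∈ A, ∀ a ∈ A, l * (f u - f v) ≤ f b - f a := by
    intro u hu v hv a ha
    rcases le_total (f u) (f a) with h | h
    · nlinarith [hle' a ha v hv]
    · nlinarith [hle' u hu v hv]
  have key_abs : ∀ u ∈ A, ∀ v ∈ A, ∀ a ∈ A, l * |f u - f v| ≤ |f b - f a| := by
    intro u hu v hv a ha
    refine le_trans ?_ (le_abs_self _)
    rcases abs_cases (f u - f v) with ⟨h, -⟩ | ⟨h, -⟩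
    · rw [h]; exact key u hu v hv a ha
    · rw [h, neg_sub]; exact key v hv u hu a ha
  refine le_trans ?_ (le_iSup _ f)
  set D := ⨆ a ∈ A, ⨆ a' ∈ A, ENNReal.ofReal |f a - f a'| with hD
  set N := ⨆ b ∈ B, ⨅ a ∈ A, ENNReal.ofReal |f b - f a| with hN
  have hDle : ∀ a ∈ A, ENNReal.ofReal l * D ≤ ENNReal.ofReal |f b - f a| := by
    intro a ha
    simp only [hD, ENNReal.mul_iSup]
    refine iSup₂_le fun u hu ↦ iSup₂_le fun v hv ↦ ?_
    rw [← ENNReal.ofReal_mul hl.le]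
    exact ENNReal.ofReal_le_ofReal (key_abs u hu v hv a ha)
  have hNb : (⨅ a ∈ A, ENNReal.ofReal |f b - f a|) ≤ N := le_iSup₂_of_le b hb le_rfl
  have hDtop : D ≠ ⊤ := by
    intro h
    have := hDle a₀ ha₀
    rw [h, ENNReal.mul_top (by simpa using hl)] at this
    exact ENNReal.ofReal_ne_top (top_le_iff.1 this)
  by_cases hD0 : D = 0
  · have hconst : ∀ u ∈ A, ∀ v ∈ A, f u = f v := by
      intro u hu v hv
      have : ENNReal.ofReal |f u - f v| ≤ D :=
        le_iSup₂_of_le u hu (le_iSup₂_of_le v hv le_rfl)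
      rw [hD0, nonpos_iff_eq_zero, ENNReal.ofReal_eq_zero] at this
      exact sub_eq_zero.1 (abs_nonpos_iff.1 this)
    have hpb : f p < f b := by
      rw [hconst q hq p hp] at hclt
      linarith
    have hN0 : N ≠ 0 := by
      refine (lt_of_lt_of_le (b := ENNReal.ofReal |f b - f p|) ?_
        (le_trans (le_iInf₂ fun a ha ↦ ?_) hNb)).ne'
      · simpa [sub_eq_zero] using hpb.ne'
      · rw [hconst a ha p hp]
    rw [hD0, ENNReal.div_zero hN0]
    exact le_top
  · rw [ENNReal.le_div_iff_mul_le (Or.inl hD0) (Or.inl hDtop)]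
    exact (le_iInf₂ hDle).trans hNb

/-- For convex sets `A ⊆ B ⊆ ℝ^d`,
`rdist(A,B) = inf { λ ≥ 0 : B ⊆ (1+λ)·A − λ·A }`, the infimum of the empty set being `∞`. -/
theorem relDist_eq_iInf_blowup (d : ℕ) (A B : Set (Fin d → ℝ))
    (hA : Convex ℝ A) (hB : Convex ℝ B) (hAB : A ⊆ B) :
    relDist A B =
      ⨅ lam ∈ {l : ℝ | 0 ≤ l ∧
          B ⊆ {x | ∃ a ∈ A, ∃ a' ∈ A, x = (1 + l) • a - l • a'}},
        ENNReal.ofReal lam := by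
  refine le_antisymm (le_iInf₂ fun l hl ↦ relDist_le_ofReal hl.1 hl.2) ?_
  by_contra! hlt
  obtain ⟨r, hr, hr'⟩ := ENNReal.lt_iff_exists_nnreal_btwn.1 hlt
  rw [← ENNReal.ofReal_coe_nnreal] at hr hr'
  have hnot : ¬ B ⊆ {x | ∃ a ∈ A, ∃ a' ∈ A, x = (1 + (r : ℝ)) • a - (r : ℝ) • a'} :=
    fun h ↦ hr'.not_ge (iInf₂_le (r : ℝ) ⟨r.2, h⟩)
  obtain ⟨b, hb, hbA⟩ := Set.not_subset.1 hnot
  exact hr.not_ge (ofReal_le_relDist hA r.2 hb hbA)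
end

section
/- For any convex sets A ⊆ B ⊆ C in ℝ^d, rdist(A,C) ≤ rdist(A,B) + rdist(B,C) + 2·rdist(A,B)·rdist(B,C). -/
open scoped ENNReal Pointwise

section SupInfDistances

variable {X : Type*} (f : X → ℝ)

theorem ofReal_abs_sub_le_add (x y z : ℝ) :
    ENNReal.ofReal |x - z| ≤ ENNReal.ofReal |x - y| + ENNReal.ofReal |y - z| := by
  rw [← ENNReal.ofReal_add (abs_nonneg _) (abs_nonneg _)]
  exact ENNReal.ofReal_le_ofReal (abs_sub_le x y z)

theorem iSup_iInf_ofReal_abs_sub_triangle (A B C : Set X) :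
    (⨆ c ∈ C, ⨅ a ∈ A, ENNReal.ofReal |f c - f a|) ≤
      (⨆ b ∈ B, ⨅ a ∈ A, ENNReal.ofReal |f b - f a|) +
        ⨆ c ∈ C, ⨅ b ∈ B, ENNReal.ofReal |f c - f b| := by
  refine iSup₂_le fun c hc => ?_
  refine le_trans ?_ (add_le_add_right
    (le_iSup₂ (f := fun c (_ : c ∈ C) => ⨅ b ∈ B, ENNReal.ofReal |f c - f b|) c hc) _)
  simp only [ENNReal.add_iInf]
  refine le_iInf₂ fun b hb => ?_
  refine le_trans ?_ (add_le_add_left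
    (le_iSup₂ (f := fun b (_ : b ∈ B) => ⨅ a ∈ A, ENNReal.ofReal |f b - f a|) b hb) _)
  simp only [ENNReal.iInf_add]
  refine le_iInf₂ fun a ha => (iInf₂_le a ha).trans ?_
  rw [add_comm]
  exact ofReal_abs_sub_le_add _ _ _

theorem iSup_ofReal_abs_sub_le_add_two_mul (A B : Set X) :
    (⨆ b ∈ B, ⨆ b' ∈ B, ENNReal.ofReal |f b - f b'|) ≤
      (⨆ a ∈ A, ⨆ a' ∈ A, ENNReal.ofReal |f a - f a'|) +
        2 * ⨆ b ∈ B, ⨅ a ∈ A, ENNReal.ofReal |f b - f a| := by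
  refine iSup₂_le fun b hb => iSup₂_le fun b' hb' => ?_
  have key (x : X) (hx : x ∈ B) :=
    le_iSup₂ (f := fun b (_ : b ∈ B) => ⨅ a ∈ A, ENNReal.ofReal |f b - f a|) x hx
  rw [two_mul]
  refine le_trans ?_ (add_le_add_right (add_le_add (key b hb) (key b' hb')) _)
  simp only [ENNReal.add_iInf, ENNReal.iInf_add]
  refine le_iInf₂ fun a' ha' => le_iInf₂ fun a ha => ?_
  have hdiam : ENNReal.ofReal |f a - f a'| ≤
      ⨆ a ∈ A, ⨆ a' ∈ A, ENNReal.ofReal |f a - f a'| :=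
    (le_iSup₂ (f := fun a' (_ : a' ∈ A) => ENNReal.ofReal |f a - f a'|) a' ha').trans
      (le_iSup₂ (f := fun a (_ : a ∈ A) => ⨆ a' ∈ A, ENNReal.ofReal |f a - f a'|) a ha)
  calc ENNReal.ofReal |f b - f b'|
      ≤ ENNReal.ofReal |f b - f a| +
          (ENNReal.ofReal |f a - f a'| + ENNReal.ofReal |f a' - f b'|) :=
        (ofReal_abs_sub_le_add _ (f a) _).trans
          (add_le_add_right (ofReal_abs_sub_le_add _ _ _) _)
    _ = ENNReal.ofReal |f a - f a'| +
          (ENNReal.ofReal |f b - f a| + ENNReal.ofReal |f b' - f a'|) := by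
        rw [abs_sub_comm (f a') (f b')]; ring
    _ ≤ _ := add_le_add_left hdiam _

end SupInfDistances

theorem iSup_iInf_le_relDist_mul {ι : Type*} {A B : Set (ι → ℝ)} (h : relDist A B ≠ ∞)
    (π : (ι → ℝ) →ₗ[ℝ] ℝ)
    (hπ : (⨆ a ∈ A, ⨆ a' ∈ A, ENNReal.ofReal |π a - π a'|) ≠ ∞) :
    (⨆ b ∈ B, ⨅ a ∈ A, ENNReal.ofReal |π b - π a|) ≤
      relDist A B * ⨆ a ∈ A, ⨆ a' ∈ A, ENNReal.ofReal |π a - π a'| := by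
  rw [← ENNReal.div_le_iff_le_mul (Or.inr h) (Or.inl hπ)]
  exact le_iSup (fun π : (ι → ℝ) →ₗ[ℝ] ℝ =>
    (⨆ b ∈ B, ⨅ a ∈ A, ENNReal.ofReal |π b - π a|) /
      (⨆ a ∈ A, ⨆ a' ∈ A, ENNReal.ofReal |π a - π a'|)) π

/-- For convex sets `A ⊆ B ⊆ C` in `ℝ^d`,
`rdist(A,C) ≤ rdist(A,B) + rdist(B,C) + 2·rdist(A,B)·rdist(B,C)`, in `[0,∞]`. -/
theorem relDist_triangle (d : ℕ) (A B C : Set (Fin d → ℝ))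
    (hA : Convex ℝ A) (hB : Convex ℝ B) (hC : Convex ℝ C)
    (hAB : A ⊆ B) (hBC : B ⊆ C) :
    relDist A C ≤ relDist A B + relDist B C + 2 * relDist A B * relDist B C := by
  by_cases h₁ : relDist A B = ∞
  · simp [h₁]
  by_cases h₂ : relDist B C = ∞
  · simp [h₂]
  refine iSup_le fun π => ?_
  by_cases hDA : (⨆ a ∈ A, ⨆ a' ∈ A, ENNReal.ofReal |π a - π a'|) = ∞
  · simp [hDA]
  have hNAB := iSup_iInf_le_relDist_mul h₁ π hDA
  have hDB := (iSup_ofReal_abs_sub_le_add_two_mul π A B).trans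
    (add_le_add_right (mul_le_mul_right hNAB 2) _)
  have hDB_ne : (⨆ b ∈ B, ⨆ b' ∈ B, ENNReal.ofReal |π b - π b'|) ≠ ∞ := by
    refine ne_top_of_le_ne_top ?_ hDB
    finiteness
  have hNBC := (iSup_iInf_le_relDist_mul h₂ π hDB_ne).trans (mul_le_mul_right hDB _)
  refine ENNReal.div_le_of_le_mul ?_
  calc _ ≤ _ := iSup_iInf_ofReal_abs_sub_triangle π A B C
    _ ≤ _ := add_le_add hNAB hNBC
    _ = _ := by ring
end

section
/- Let t be a positive integer and let A_1,…,A_t, B_1,…,B_t ⊆ ℝ^d be convex sets with A_i ⊆ B_i for all i ∈ {1,…,t}. Then rdist( conv(⋃_{i=1}^t A_i), conv(⋃_{i=1}^t B_i) ) ≤ max_{i∈{1,…,t}} rdist(A_i, B_i). -/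
open scoped ENNReal Pointwise

/-- Sublevel sets of the distance to a convex set, measured along a linear functional,
are convex. -/
lemma convex_setOf_iInf_ofReal_abs_sub_le {E : Type*} [AddCommGroup E] [Module ℝ E]
    {A : Set E} (hA : Convex ℝ A) (π : E →ₗ[ℝ] ℝ) (c : ℝ≥0∞) :
    Convex ℝ {x | (⨅ a ∈ A, ENNReal.ofReal |π x - π a|) ≤ c} := by
  intro x hx y hy s t hs ht hst
  rw [Set.mem_ofPred_eq] at hx hy ⊢
  refine le_of_forall_gt_imp_ge_of_dense fun c' hc' => ?_
  obtain ⟨a, ha, hxa⟩ : ∃ a ∈ A, ENNReal.ofReal |π x - π a| < c' := by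
    simpa only [iInf_lt_iff, exists_prop] using lt_of_le_of_lt hx hc'
  obtain ⟨b, hb, hyb⟩ : ∃ b ∈ A, ENNReal.ofReal |π y - π b| < c' := by
    simpa only [iInf_lt_iff, exists_prop] using lt_of_le_of_lt hy hc'
  have hmax : |π (s • x + t • y) - π (s • a + t • b)| ≤ max |π x - π a| |π y - π b| := by
    have h : π (s • x + t • y) - π (s • a + t • b) = s * (π x - π a) + t * (π y - π b) := by
      simp only [map_add, map_smul, smul_eq_mul]
      ring
    calc |π (s • x + t • y) - π (s • a + t • b)|
        ≤ s * |π x - π a| + t * |π y - π b| := by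
          rw [h]
          refine (abs_add_le _ _).trans_eq ?_
          rw [abs_mul, abs_mul, abs_of_nonneg hs, abs_of_nonneg ht]
      _ ≤ max |π x - π a| |π y - π b| := Convex.combo_le_max _ _ hs ht hst
  refine (iInf₂_le _ (hA ha hb hs ht hst)).trans ((ENNReal.ofReal_le_ofReal hmax).trans ?_)
  rw [ENNReal.ofReal_max]
  exact max_le hxa.le hyb.le

/-- For convex sets `A_i ⊆ B_i ⊆ ℝ^d`, `i = 1, …, t`,
`rdist(conv(⋃ A_i), conv(⋃ B_i)) ≤ max_i rdist(A_i, B_i)`. -/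
theorem relDist_convexHull_union (d t : ℕ) (ht : 0 < t)
    (A B : Fin t → Set (Fin d → ℝ))
    (hA : ∀ i, Convex ℝ (A i)) (hB : ∀ i, Convex ℝ (B i)) (hAB : ∀ i, A i ⊆ B i) :
    relDist (convexHull ℝ (⋃ i, A i)) (convexHull ℝ (⋃ i, B i)) ≤
      ⨆ i, relDist (A i) (B i) := by
  set r := ⨆ i, relDist (A i) (B i)
  rcases eq_or_ne r ⊤ with hr_top | hr_top
  · exact hr_top ▸ le_top
  refine iSup_le fun π => ?_
  set C := convexHull ℝ (⋃ i, A i)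
  have hAC : ∀ i, A i ⊆ C := fun i =>
    (Set.subset_iUnion A i).trans (subset_convexHull ℝ _)
  set D := ⨆ a ∈ C, ⨆ a' ∈ C, ENNReal.ofReal |π a - π a'|
  rcases eq_or_ne D ⊤ with hD_top | hD_top
  · rw [hD_top, ENNReal.div_top]
    exact zero_le
  refine ENNReal.div_le_of_le_mul (iSup₂_le fun b hb => ?_)
  refine convexHull_min (Set.iUnion_subset fun i x hx => ?_)
    (convex_setOf_iInf_ofReal_abs_sub_le (convex_convexHull ℝ _) π (r * D)) hb
  have hdiam : (⨆ a ∈ A i, ⨆ a' ∈ A i, ENNReal.ofReal |π a - π a'|) ≤ D :=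
    iSup₂_le fun a ha => iSup₂_le fun a' ha' =>
      le_iSup₂_of_le a (hAC i ha) (le_iSup₂_of_le a' (hAC i ha') le_rfl)
  have hquot := (le_iSup (fun π : (Fin d → ℝ) →ₗ[ℝ] ℝ =>
    (⨆ b ∈ B i, ⨅ a ∈ A i, ENNReal.ofReal |π b - π a|) /
      (⨆ a ∈ A i, ⨆ a' ∈ A i, ENNReal.ofReal |π a - π a'|)) π).trans
    (le_iSup (fun i => relDist (A i) (B i)) i)
  rw [ENNReal.div_le_iff_le_mul (Or.inr hr_top)
    (Or.inl (ne_top_of_le_ne_top hD_top hdiam))] at hquot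
  calc (⨅ a ∈ C, ENNReal.ofReal |π x - π a|)
      ≤ ⨅ a ∈ A i, ENNReal.ofReal |π x - π a| := biInf_mono fun a ha => hAC i ha
    _ ≤ ⨆ b ∈ B i, ⨅ a ∈ A i, ENNReal.ofReal |π b - π a| :=
        le_iSup₂ (f := fun b (_ : b ∈ B i) => ⨅ a ∈ A i, ENNReal.ofReal |π b - π a|) x hx
    _ ≤ r * (⨆ a ∈ A i, ⨆ a' ∈ A i, ENNReal.ofReal |π a - π a'|) := hquot
    _ ≤ r * D := by gcongr
end

section
/- Let A ⊆ B ⊆ ℝ^d_{≥0} be two non-empty convex sets such that A is down-closed. Then rdist(A,B) = LPgapMax(A,B). -/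
open scoped ENNReal Pointwise

/-- The maximization gap between non-empty convex sets `A ⊆ B ⊆ ℝ^d_{≥0}`:
`inf { ε ≥ 0 : ∀ c ≥ 0, (1+ε)·sup_{a ∈ A} cᵀa ≥ sup_{b ∈ B} cᵀb }`, with value `∞`
if no such `ε` exists. -/
noncomputable def LPgapMax {d : ℕ} (A B : Set (Fin d → ℝ)) : ℝ≥0∞ :=
  ⨅ ε ∈ {e : ℝ | 0 ≤ e ∧ ∀ c : Fin d → ℝ, (∀ i, 0 ≤ c i) →
      (⨆ b ∈ B, ENNReal.ofReal (∑ i, c i * b i)) ≤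
        (1 + ENNReal.ofReal e) * ⨆ a ∈ A, ENNReal.ofReal (∑ i, c i * a i)},
    ENNReal.ofReal ε

lemma linearMap_apply_eq_sum {d : ℕ} (π : (Fin d → ℝ) →ₗ[ℝ] ℝ) (x : Fin d → ℝ) :
    π x = ∑ i, π (Pi.single i 1) * x i := by
  rw [LinearMap.pi_apply_eq_sum_univ π x]
  refine Finset.sum_congr rfl fun i _ => ?_
  rw [smul_eq_mul, mul_comm]
  congr 2
  ext j
  simp [Pi.single_apply, eq_comm]

/-- The relative distance bounds the relative gap of every nonnegative objective. -/
lemma iSup_le_one_add_relDist_mul {d : ℕ} {A B : Set (Fin d → ℝ)}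
    (hApos : A ⊆ {x | ∀ i, 0 ≤ x i}) (hfin : relDist A B ≠ ∞)
    (c : Fin d → ℝ) (hc : ∀ i, 0 ≤ c i) :
    (⨆ b ∈ B, ENNReal.ofReal (∑ i, c i * b i)) ≤
      (1 + relDist A B) * ⨆ a ∈ A, ENNReal.ofReal (∑ i, c i * a i) := by
  set S := ⨆ a ∈ A, ENNReal.ofReal (∑ i, c i * a i) with hS
  by_cases hStop : S = ∞
  · simp [hStop]
  let π : (Fin d → ℝ) →ₗ[ℝ] ℝ := Fintype.linearCombination ℝ c
  have hπ : ∀ x, π x = ∑ i, c i * x i := fun x => by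
    simp [π, Fintype.linearCombination_apply, mul_comm]
  have hle : ∀ a ∈ A, ENNReal.ofReal (π a) ≤ S := fun a ha => by
    rw [hπ, hS]
    exact le_iSup₂ (f := fun (a : Fin d → ℝ) (_ : a ∈ A) => ENNReal.ofReal (∑ i, c i * a i)) a ha
  have hnonneg : ∀ a ∈ A, 0 ≤ π a := fun a ha => by
    rw [hπ]
    exact Finset.sum_nonneg fun i _ => mul_nonneg (hc i) (hApos ha i)
  set D := ⨆ a ∈ A, ⨆ a' ∈ A, ENNReal.ofReal |π a - π a'|
  have hDS : D ≤ S := by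
    refine iSup₂_le fun a ha => iSup₂_le fun a' ha' => ?_
    rcases abs_cases (π a - π a') with h | h
    · exact (ENNReal.ofReal_le_ofReal (by linarith [hnonneg a' ha'])).trans (hle a ha)
    · exact (ENNReal.ofReal_le_ofReal (by linarith [hnonneg a ha])).trans (hle a' ha')
  have hdist : (⨆ b ∈ B, ⨅ a ∈ A, ENNReal.ofReal |π b - π a|) ≤ relDist A B * D := by
    rw [← ENNReal.div_le_iff_le_mul (Or.inr hfin) (Or.inl (ne_top_of_le_ne_top hStop hDS))]
    exact le_iSup (fun π : (Fin d → ℝ) →ₗ[ℝ] ℝ =>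
      (⨆ b ∈ B, ⨅ a ∈ A, ENNReal.ofReal |π b - π a|) /
        (⨆ a ∈ A, ⨆ a' ∈ A, ENNReal.ofReal |π a - π a'|)) π
  refine iSup₂_le fun b hb => ?_
  rw [← hπ]
  calc ENNReal.ofReal (π b) ≤ (⨅ a ∈ A, ENNReal.ofReal |π b - π a|) + S := by
        rw [← tsub_le_iff_right]
        refine le_iInf₂ fun a ha => ?_
        rw [tsub_le_iff_right]
        calc ENNReal.ofReal (π b) ≤ ENNReal.ofReal (|π b - π a| + π a) :=
              ENNReal.ofReal_le_ofReal (by linarith [le_abs_self (π b - π a)])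
          _ ≤ ENNReal.ofReal |π b - π a| + ENNReal.ofReal (π a) := ENNReal.ofReal_add_le
          _ ≤ _ := by gcongr; exact hle a ha
    _ ≤ relDist A B * S + S := by
        gcongr
        refine le_trans ?_ (hdist.trans (by gcongr))
        exact le_iSup₂ (f := fun (b : Fin d → ℝ) (_ : b ∈ B) =>
          ⨅ a ∈ A, ENNReal.ofReal |π b - π a|) b hb
    _ = (1 + relDist A B) * S := by ring

/-- A relative gap valid for all nonnegative objectives bounds the distance of the image of
a point of `B` from the image of the down-closed set `A`, on the nonnegative side. -/
lemma iInf_dist_le_mul_diam_of_nonneg {d : ℕ} {A B : Set (Fin d → ℝ)}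
    (hA : Convex ℝ A) (h0 : (0 : Fin d → ℝ) ∈ A)
    (hAB : A ⊆ B) (hBpos : B ⊆ {x | ∀ i, 0 ≤ x i})
    (hdown : ∀ x ∈ A, ∀ y : Fin d → ℝ, (∀ i, 0 ≤ y i) → (∀ i, y i ≤ x i) → y ∈ A)
    {ε : ℝ≥0∞} (hε : ∀ c : Fin d → ℝ, (∀ i, 0 ≤ c i) →
      (⨆ b ∈ B, ENNReal.ofReal (∑ i, c i * b i)) ≤
        (1 + ε) * ⨆ a ∈ A, ENNReal.ofReal (∑ i, c i * a i))
    (π : (Fin d → ℝ) →ₗ[ℝ] ℝ)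
    (hD : (⨆ a ∈ A, ⨆ a' ∈ A, ENNReal.ofReal |π a - π a'|) ≠ ∞)
    {b : Fin d → ℝ} (hb : b ∈ B) (hπb : 0 ≤ π b) :
    (⨅ a ∈ A, ENNReal.ofReal |π b - π a|) ≤
      ε * ⨆ a ∈ A, ⨆ a' ∈ A, ENNReal.ofReal |π a - π a'| := by
  by_cases hex : ∃ a ∈ A, π b ≤ π a
  · obtain ⟨a, ha, hle⟩ := hex
    rcases hπb.eq_or_lt with hz | hpos
    · refine (iInf₂_le (0 : Fin d → ℝ) h0).trans ?_
      simp [← hz]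
    · have hapos : 0 < π a := hpos.trans_le hle
      have hmem : (π b / π a) • a ∈ A :=
        hA.smul_mem_of_zero_mem h0 ha ⟨by positivity, div_le_one_of_le₀ hle hapos.le⟩
      refine (iInf₂_le _ hmem).trans ?_
      rw [map_smul, smul_eq_mul, div_mul_cancel₀ _ hapos.ne']
      simp
  push Not at hex
  set D := ⨆ a ∈ A, ⨆ a' ∈ A, ENNReal.ofReal |π a - π a'|
  let p : Fin d → ℝ := fun i => max (π (Pi.single i 1)) 0
  have hp : ∀ i, 0 ≤ p i := fun i => le_max_right _ _
  set S := ⨆ a ∈ A, ENNReal.ofReal (∑ i, p i * a i) with hS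
  have hpos_part : ∀ a ∈ A, ∃ a' ∈ A, π a' = ∑ i, p i * a i := by
    intro a ha
    have ha0 := hBpos (hAB ha)
    refine ⟨fun i => if 0 ≤ π (Pi.single i 1) then a i else 0,
      hdown a ha _ (fun i => ?_) (fun i => ?_), ?_⟩
    · split_ifs
      exacts [ha0 i, le_rfl]
    · split_ifs
      exacts [le_rfl, ha0 i]
    · rw [linearMap_apply_eq_sum π]
      refine Finset.sum_congr rfl fun i _ => ?_
      by_cases h : 0 ≤ π (Pi.single i 1)
      · simp [p, h]
      · simp [p, h, max_eq_right (not_le.mp h).le]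
  have hSD : S ≤ D := by
    refine iSup₂_le fun a ha => ?_
    obtain ⟨a', ha', h⟩ := hpos_part a ha
    rw [← h]
    calc ENNReal.ofReal (π a') ≤ ENNReal.ofReal |π a' - π 0| :=
          ENNReal.ofReal_le_ofReal (by simpa using le_abs_self (π a'))
      _ ≤ ⨆ x ∈ A, ENNReal.ofReal |π a' - π x| :=
          le_iSup₂ (f := fun (x : Fin d → ℝ) (_ : x ∈ A) => ENNReal.ofReal |π a' - π x|) 0 h0
      _ ≤ D := le_iSup₂ (f := fun (a : Fin d → ℝ) (_ : a ∈ A) =>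
          ⨆ x ∈ A, ENNReal.ofReal |π a - π x|) a' ha'
  have hStop : S ≠ ∞ := ne_top_of_le_ne_top hD hSD
  have hπp : π b ≤ ∑ i, p i * b i := by
    rw [linearMap_apply_eq_sum π]
    exact Finset.sum_le_sum fun i _ => mul_le_mul_of_nonneg_right (le_max_left _ _) (hBpos hb i)
  have hup : ENNReal.ofReal (π b) ≤ (1 + ε) * S :=
    (ENNReal.ofReal_le_ofReal hπp).trans <| le_trans
      (le_iSup₂ (f := fun (b : Fin d → ℝ) (_ : b ∈ B) =>
        ENNReal.ofReal (∑ i, p i * b i)) b hb) (hε p hp)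
  have hadd : (⨅ a ∈ A, ENNReal.ofReal |π b - π a|) + S ≤ ENNReal.ofReal (π b) := by
    rw [hS, ENNReal.add_biSup' ⟨0, h0⟩]
    refine iSup₂_le fun a ha => ?_
    obtain ⟨a', ha', h⟩ := hpos_part a ha
    have hnn : 0 ≤ π a' := by
      rw [h]
      exact Finset.sum_nonneg fun i _ => mul_nonneg (hp i) (hBpos (hAB ha) i)
    have hlt := hex a' ha'
    rw [← h]
    calc _ ≤ ENNReal.ofReal |π b - π a'| + ENNReal.ofReal (π a') := by
          gcongr
          exact iInf₂_le a' ha'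
      _ = ENNReal.ofReal (π b) := by
          rw [abs_of_pos (sub_pos.mpr hlt), ← ENNReal.ofReal_add (sub_pos.mpr hlt).le hnn,
            sub_add_cancel]
  have hfin : (⨅ a ∈ A, ENNReal.ofReal |π b - π a|) + S ≤ ε * S + S :=
    (hadd.trans hup).trans_eq (by ring)
  exact (ENNReal.le_of_add_le_add_right hStop hfin).trans (by gcongr)

/-- For non-empty convex sets `A ⊆ B ⊆ ℝ^d_{≥0}` with `A` down-closed,
`rdist(A,B) = LPgapMax(A,B)`. -/
theorem relDist_eq_LPgapMax (d : ℕ) (A B : Set (Fin d → ℝ))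
    (hA : Convex ℝ A) (hB : Convex ℝ B)
    (hAne : A.Nonempty) (hBne : B.Nonempty)
    (hAB : A ⊆ B) (hBpos : B ⊆ {x | ∀ i, 0 ≤ x i})
    (hdown : ∀ x ∈ A, ∀ y : Fin d → ℝ, (∀ i, 0 ≤ y i) → (∀ i, y i ≤ x i) → y ∈ A) :
    relDist A B = LPgapMax A B := by
  have hApos := hAB.trans hBpos
  have h0 : (0 : Fin d → ℝ) ∈ A := by
    obtain ⟨a, ha⟩ := hAne
    exact hdown a ha 0 (fun _ => le_rfl) (hApos ha)
  refine le_antisymm (le_iInf₂ fun e he => iSup_le fun π => ?_) ?_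
  · by_cases hD : (⨆ a ∈ A, ⨆ a' ∈ A, ENNReal.ofReal |π a - π a'|) = ∞
    · simp [hD]
    refine ENNReal.div_le_of_le_mul (iSup₂_le fun b hb => ?_)
    rcases le_total 0 (π b) with hπb | hπb
    · exact iInf_dist_le_mul_diam_of_nonneg hA h0 hAB hBpos hdown he.2 π hD hb hπb
    · have habs : ∀ x y, |(-π) x - (-π) y| = |π x - π y| := fun x y => by
        rw [LinearMap.neg_apply, LinearMap.neg_apply, neg_sub_neg, abs_sub_comm]
      simpa only [habs] using iInf_dist_le_mul_diam_of_nonneg hA h0 hAB hBpos hdown he.2 (-π)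
        (by simpa only [habs] using hD) hb (by simpa using hπb)
  · by_cases hfin : relDist A B = ∞
    · simp [hfin]
    have hgap := iSup_le_one_add_relDist_mul hApos hfin
    have hr := ENNReal.ofReal_toReal hfin
    calc LPgapMax A B ≤ ENNReal.ofReal (relDist A B).toReal :=
          iInf₂_le (relDist A B).toReal
            ⟨ENNReal.toReal_nonneg, fun c hc => by simpa only [hr] using hgap c hc⟩
      _ = relDist A B := hr
end
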